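/- arXiv:1206.6114 — 2 statements merged into one kernel-verified Lean document; each statement's English description precedes it below -/
import Mathlib

section
/- There exist a time T > 0 and positive constants A, c₁, c₂, C and ρ, all independent of N, such that for every N ≥ 1 and every initial configuration ξ ∈ ℕ^N of the N-particle Fleming-Viot system, E[exp(ρ R(ξ^ξ_T))] − exp(ρ R(ξ)) < −c₁ e^{ρR(ξ)} 1{R(ξ) > A} + N c₂ e^{−C R(ξ)}, where ξ^ξ_T is the Fleming-Viot configuration at time T started from ξ. -/
open MeasureTheory Filter Topology Set

noncomputable section

/-- Jump rates of the continuous-time Galton-Watson process: from `x ≥ 1`,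
jump to `x - 1` at rate `x p(0)` and to `y > x` at rate `x p(y - x + 1)`;
the state `0` is absorbing. -/
def gwRate (p : ℕ → ℝ) (x y : ℕ) : ℝ :=
  if 1 ≤ x ∧ y + 1 = x then (x : ℝ) * p 0
  else if 1 ≤ x ∧ x < y then (x : ℝ) * p (y - x + 1)
  else 0

/-- The offspring law: a probability on ℕ with a finite positive exponential
moment and negative (subcritical) drift `-v = ∑_{ℓ ≥ -1} ℓ p(ℓ+1) < 0`. -/
structure OffspringLaw (p : ℕ → ℝ) (σ v : ℝ) : Prop where
  nonneg : ∀ k, 0 ≤ p k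
  total : ∑' k : ℕ, p k = 1
  sigma_pos : 0 < σ
  expMoment : Summable fun k : ℕ => p k * Real.exp (σ * k)
  v_pos : 0 < v
  drift : ∑' k : ℕ, ((k : ℝ) - 1) * p k = -v

/-- Empirical distribution of an `N`-particle configuration. -/
def emp (N : ℕ) (x : ℕ) (ξ : Fin N → ℕ) : ℝ :=
  (N : ℝ)⁻¹ * ∑ i : Fin N, (if ξ i = x then (1 : ℝ) else 0)

/-- Fleming-Viot generator for general driving rates `q`. -/
def fvGenQ (q : ℕ → ℕ → ℝ) (N : ℕ) (f : (Fin N → ℕ) → ℝ) (ξ : Fin N → ℕ) : ℝ :=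
  ∑ i : Fin N, ∑' y : ℕ,
    (if 1 ≤ y then
        q (ξ i) y + q (ξ i) 0 * ((N : ℝ) / ((N : ℝ) - 1)) * emp N y ξ
      else 0) * (f (Function.update ξ i y) - f ξ)

/-- Fleming-Viot generator driven by the Galton-Watson rates. -/
def fvGen (p : ℕ → ℝ) (N : ℕ) : ((Fin N → ℕ) → ℝ) → (Fin N → ℕ) → ℝ :=
  fvGenQ (gwRate p) N

/-- Bounded real observables. -/
def Bounded {S : Type*} (f : S → ℝ) : Prop := ∃ C, ∀ x, |f x| ≤ C

/-- A Markov transition semigroup on a measurable state space. -/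
structure MarkovSemigroup (S : Type*) [MeasurableSpace S] where
  P : ℝ → S → Measure S
  meas : ∀ t, Measurable (P t)
  prob : ∀ t x, IsProbabilityMeasure (P t x)
  init : ∀ x, P 0 x = Measure.dirac x
  semigroup : ∀ s t : ℝ, 0 ≤ s → 0 ≤ t → ∀ x, P (s + t) x = (P s x).bind (P t)

/-- `K` is the transition semigroup of the `N`-particle Fleming-Viot process
driven by the rates `q`: it solves the Kolmogorov equation for the
Fleming-Viot generator on bounded observables. -/
def IsFVQSemigroup (q : ℕ → ℕ → ℝ) (N : ℕ) (K : MarkovSemigroup (Fin N → ℕ)) : Prop :=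
  ∀ f : (Fin N → ℕ) → ℝ, Bounded f → Measurable f → ∀ ξ, ∀ t : ℝ, 0 ≤ t →
    HasDerivWithinAt (fun u => ∫ η, f η ∂ K.P u ξ)
      (∫ η, fvGenQ q N f η ∂ K.P t ξ) (Set.Ici 0) t

/-- `K` is the `N`-particle Fleming-Viot semigroup driven by Galton-Watson. -/
def IsFVSemigroup (p : ℕ → ℝ) (N : ℕ) (K : MarkovSemigroup (Fin N → ℕ)) : Prop :=
  IsFVQSemigroup (gwRate p) N K

/-- Invariant (stationary) measure of a Markov semigroup. -/
def Invariant {S : Type*} [MeasurableSpace S] (K : MarkovSemigroup S) (μ : Measure S) : Prop :=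
  ∀ t : ℝ, 0 ≤ t → μ.bind (K.P t) = μ

/-- Transition probabilities of the Galton-Watson process (absorbed at 0),
characterized by the Kolmogorov backward equations. -/
structure GWTransition (p : ℕ → ℝ) where
  pt : ℝ → ℕ → ℕ → ℝ
  nonneg : ∀ t x y, 0 ≤ pt t x y
  total : ∀ t x, 0 ≤ t → ∑' y : ℕ, pt t x y = 1
  init : ∀ x y, pt 0 x y = if y = x then 1 else 0
  backward : ∀ x y, ∀ t : ℝ, 0 ≤ t →
    HasDerivWithinAt (fun s => pt s x y)
      (∑' z : ℕ, gwRate p x z * (pt t z y - pt t x y)) (Set.Ici 0) t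

/-- The law at time `t` of the process started from `μ`, conditioned on
non-absorption up to time `t`. -/
def condLaw (pt : ℝ → ℕ → ℕ → ℝ) (μ : ℕ → ℝ) (t : ℝ) (y : ℕ) : ℝ :=
  (∑' x : ℕ, μ x * pt t x y) /
    ∑' x : ℕ, ∑' z : ℕ, (if 1 ≤ z then μ x * pt t x z else 0)

def diracOne : ℕ → ℝ := fun x => if x = 1 then 1 else 0

/-- `ν` is the Yaglom limit (the minimal quasi-stationary distribution). -/
def IsYaglomLimit (pt : ℝ → ℕ → ℕ → ℝ) (ν : ℕ → ℝ) : Prop :=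
  ∀ y : ℕ, Tendsto (fun t => condLaw pt diracOne t y) atTop (𝓝 (ν y))

/-- Position of the rightmost particle. -/
def rmax (N : ℕ) (ξ : Fin N → ℕ) : ℕ := Finset.univ.sup ξ

/-- Ratio of the second to the first empirical moment. -/
def psiFun (N : ℕ) (ξ : Fin N → ℕ) : ℝ :=
  (∑ i : Fin N, (ξ i : ℝ) ^ 2) / ∑ i : Fin N, (ξ i : ℝ)

/-- Configurations of the multitype branching process: `ζ (i, x)` is the
number of type-`i` individuals at site `x`. -/
abbrev BConf (N : ℕ) := Fin N × ℕ → ℕ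

/-- Total number of individuals. -/
def bTotal (N : ℕ) (ζ : BConf N) : ENNReal := ∑' w : Fin N × ℕ, (ζ w : ENNReal)

/-- Rightmost occupied site. -/
def bRmax (N : ℕ) (ζ : BConf N) : ℕ := sSup {x : ℕ | ∃ i, ζ (i, x) ≠ 0}

/-- Move one type-`i` individual from `x` to `y`. -/
def bJump (N : ℕ) (ζ : BConf N) (i : Fin N) (x y : ℕ) : BConf N :=
  fun w => if w = (i, x) then ζ w - 1 else if w = (i, y) then ζ w + 1 else ζ w

/-- Every type-`j` individual gives birth to a type-`i` individual at its own
position. -/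
def bBranch (N : ℕ) (ζ : BConf N) (i j : Fin N) : BConf N :=
  fun w => if w.1 = i then ζ w + ζ (j, w.2) else ζ w

/-- Generator of the multitype branching Markov process. -/
def branchGen (q : ℕ → ℕ → ℝ) (qbar : ℝ) (N : ℕ) (f : BConf N → ℝ) (ζ : BConf N) : ℝ :=
  (∑' w : (Fin N × ℕ) × ℕ,
      (ζ w.1 : ℝ) * (if w.2 ≠ 0 ∧ w.2 ≠ w.1.2 then q w.1.2 w.2 else 0) *
        (f (bJump N ζ w.1.1 w.1.2 w.2) - f ζ))
    + ∑ i : Fin N, ∑ j : Fin N,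
        (if j ≠ i then qbar / ((N : ℝ) - 1) * (f (bBranch N ζ i j) - f ζ) else 0)

def IsBranchSemigroup (q : ℕ → ℕ → ℝ) (qbar : ℝ) (N : ℕ)
    (B : MarkovSemigroup (BConf N)) : Prop :=
  ∀ f : BConf N → ℝ, Bounded f → Measurable f → ∀ ζ, ∀ t : ℝ, 0 ≤ t →
    HasDerivWithinAt (fun u => ∫ η, f η ∂ B.P u ζ)
      (∫ η, branchGen q qbar N f η ∂ B.P t ζ) (Set.Ici 0) t

/-- Generator of the single-particle motion with jumps to `0` suppressed. -/
def tildeGen (q : ℕ → ℕ → ℝ) (f : ℕ → ℝ) (x : ℕ) : ℝ :=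
  ∑' y : ℕ, (if y ≠ 0 ∧ y ≠ x then q x y else 0) * (f y - f x)

def IsTildeSemigroup (q : ℕ → ℕ → ℝ) (T : MarkovSemigroup ℕ) : Prop :=
  ∀ f : ℕ → ℝ, Bounded f → ∀ x, ∀ t : ℝ, 0 ≤ t →
    HasDerivWithinAt (fun u => ∫ y, f y ∂ T.P u x)
      (∫ y, tildeGen q f y ∂ T.P t x) (Set.Ici 0) t

/-- Generator of the Galton-Watson process together with its cumulative birth
counter: from `(z, b)`, jump to `(z + k - 1, b + k)` at rate `z p(k)`. -/
def gwbGen (p : ℕ → ℝ) (f : ℕ × ℕ → ℝ) (w : ℕ × ℕ) : ℝ :=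
  ∑' k : ℕ, (w.1 : ℝ) * p k * (f (w.1 + k - 1, w.2 + k) - f w)

def IsGWBSemigroup (p : ℕ → ℝ) (W : MarkovSemigroup (ℕ × ℕ)) : Prop :=
  ∀ f : ℕ × ℕ → ℝ, Bounded f → ∀ w, ∀ t : ℝ, 0 ≤ t →
    HasDerivWithinAt (fun u => ∫ z, f z ∂ W.P u w)
      (∫ z, gwbGen p f z ∂ W.P t w) (Set.Ici 0) t

/-- `E[exp(σ' H¹)] < ∞`, where `H¹ = 1 + (total number of births)` of the
Galton-Watson process started from one individual; the total number of births
is the increasing limit of the birth counter. -/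
def HMomentFinite (W : MarkovSemigroup (ℕ × ℕ)) (σ' : ℝ) : Prop :=
  ∃ M : ℝ, ∀ t : ℝ, 0 ≤ t →
    ∫⁻ w, ENNReal.ofReal (Real.exp (σ' * (1 + (w.2 : ℝ)))) ∂ W.P t (1, 0)
      ≤ ENNReal.ofReal M

/-- The class `F` of test functions: `∑_ℓ e^{-ρℓ} |f(ℓ)| < ∞` for some `ρ < σ'`. -/
def MemF (σ' : ℝ) (f : ℕ → ℝ) : Prop :=
  ∃ ρ : ℝ, ρ < σ' ∧ Summable fun ℓ : ℕ => Real.exp (-ρ * ℓ) * |f ℓ|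

/-- Galton-Watson semigroup `S_t f(x) = E f(Z^x_t)`, read off from the
birth-counting process. -/
def gwS (W : MarkovSemigroup (ℕ × ℕ)) (t : ℝ) (f : ℕ → ℝ) (x : ℕ) : ℝ :=
  ∫ w, f w.1 ∂ W.P t (x, 0)

/-- Galton-Watson generator `Q f(x) = ∑_{ℓ ≥ -1} x p(ℓ+1) (f(x+ℓ) - f(x))`. -/
def gwQ (p : ℕ → ℝ) (f : ℕ → ℝ) (x : ℕ) : ℝ :=
  ∑' k : ℕ, (x : ℝ) * p k * (f (x + k - 1) - f x)

/-- Reflected Galton-Watson generator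
`Q̃ f(x) = ∑_{ℓ ≥ -1} x p(ℓ+1) 1{x+ℓ ≥ 1} (f(x+ℓ) - f(x))`. -/
def gwQRefl (p : ℕ → ℝ) (f : ℕ → ℝ) (x : ℕ) : ℝ :=
  ∑' k : ℕ, (x : ℝ) * p k * (if 1 ≤ x + k - 1 then f (x + k - 1) - f x else 0)

def IsReflSemigroup (p : ℕ → ℝ) (R : MarkovSemigroup ℕ) : Prop :=
  ∀ f : ℕ → ℝ, Bounded f → ∀ x, ∀ t : ℝ, 0 ≤ t →
    HasDerivWithinAt (fun u => ∫ y, f y ∂ R.P u x)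
      (∫ y, gwQRefl p f y ∂ R.P t x) (Set.Ici 0) t

/-- `Γ(ρ) = p(0) + ∑_{ℓ ≥ 1} p(ℓ+1) ℓ² e^{ρℓ}`. -/
def gwGamma (p : ℕ → ℝ) (ρ : ℝ) : ℝ :=
  p 0 + ∑' ℓ : ℕ, p (ℓ + 2) * ((ℓ : ℝ) + 1) ^ 2 * Real.exp (ρ * ((ℓ : ℝ) + 1))

/-- `β = sup {ρ > 0 : ρ Γ(ρ) ≤ v}`. -/
def gwBeta (p : ℕ → ℝ) (v : ℝ) : ℝ :=
  sSup {ρ : ℝ | 0 < ρ ∧ ρ * gwGamma p ρ ≤ v}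

/-- Generating function `G(μ; z) = ∑_x μ(x) z^x`. -/
def genFn (μ : ℕ → ℝ) (z : ℝ) : ℝ := ∑' x : ℕ, μ x * z ^ x

/-- A probability distribution on the positive integers. -/
def IsProbOnPos (μ : ℕ → ℝ) : Prop :=
  (∀ x, 0 ≤ μ x) ∧ μ 0 = 0 ∧ ∑' x : ℕ, μ x = 1

/-- The class `K(α)`: probabilities on ℕ whose second-to-first moment ratio
is at most `α`. -/
def InK (α : ℝ) (μ : ℕ → ℝ) : Prop :=
  IsProbOnPos μ ∧ (Summable fun x : ℕ => (x : ℝ) ^ 2 * μ x) ∧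
    (∑' x : ℕ, (x : ℝ) ^ 2 * μ x) ≤ α * ∑' x : ℕ, (x : ℝ) * μ x

/-- The log-Laplace drift `φ(θ) = ∑ p(k) (e^{θ(k-1)} - 1)` of the Galton-Watson motion. -/
def gwPhi (p : ℕ → ℝ) (θ : ℝ) : ℝ := ∑' k : ℕ, p k * (Real.exp (θ * ((k : ℝ) - 1)) - 1)

/-- The exponential `e^{θx}` frozen beyond level `M`. -/
def capExp (θ : ℝ) (M x : ℕ) : ℝ := Real.exp (θ * ((min x M : ℕ) : ℝ))

/-- Sum over the particles of the frozen exponential. -/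
def capSum (θ : ℝ) (M N : ℕ) (ξ : Fin N → ℕ) : ℝ := ∑ i, capExp θ M (ξ i)

lemma capExp_pos (θ : ℝ) (M x : ℕ) : 0 < capExp θ M x := Real.exp_pos _

lemma capExp_mono {θ : ℝ} (hθ : 0 ≤ θ) (M : ℕ) : Monotone (capExp θ M) := by
  intro x y hxy
  unfold capExp
  gcongr

lemma capExp_le {θ : ℝ} (hθ : 0 ≤ θ) (M x : ℕ) : capExp θ M x ≤ Real.exp (θ * M) := by
  unfold capExp
  gcongr
  exact min_le_right _ _

lemma capExp_le_exp {θ : ℝ} (hθ : 0 ≤ θ) (M x : ℕ) : capExp θ M x ≤ Real.exp (θ * x) := by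
  unfold capExp
  gcongr
  exact min_le_left _ _

lemma capExp_of_le {θ : ℝ} {M x : ℕ} (h : x ≤ M) : capExp θ M x = Real.exp (θ * x) := by
  rw [capExp, min_eq_left h]

lemma capExp_of_ge {θ : ℝ} {M x : ℕ} (h : M ≤ x) : capExp θ M x = Real.exp (θ * M) := by
  rw [capExp, min_eq_right h]

lemma abs_exp_sub_one_le_mul_exp (z : ℝ) : |Real.exp z - 1| ≤ |z| * Real.exp |z| := by
  have h1 := Real.add_one_le_exp z
  have h2 : Real.exp z - 1 ≤ z * Real.exp z := by
    have h := mul_le_mul_of_nonneg_left (Real.add_one_le_exp (-z)) (Real.exp_pos z).le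
    rw [← Real.exp_add, add_neg_cancel, Real.exp_zero] at h
    linarith
  have h3 : z * Real.exp z ≤ |z| * Real.exp |z| :=
    mul_le_mul (le_abs_self z) (Real.exp_le_exp.2 (le_abs_self z)) (Real.exp_pos z).le
      (abs_nonneg z)
  have h4 : |z| ≤ |z| * Real.exp |z| :=
    le_mul_of_one_le_right (abs_nonneg z) (Real.one_le_exp (abs_nonneg z))
  rw [abs_le]
  constructor
  · linarith [neg_abs_le z]
  · linarith

namespace OffspringLaw

variable {p : ℕ → ℝ} {σ v : ℝ}

lemma summable (hp : OffspringLaw p σ v) : Summable p := by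
  by_contra h
  have := hp.total
  rw [tsum_eq_zero_of_not_summable h] at this
  exact zero_ne_one this

lemma summable_exp (hp : OffspringLaw p σ v) {θ : ℝ} (hθ : θ ≤ σ) :
    Summable fun k : ℕ => p k * Real.exp (θ * k) := by
  refine Summable.of_nonneg_of_le (fun k => mul_nonneg (hp.nonneg k) (Real.exp_pos _).le)
    (fun k => ?_) hp.expMoment
  have := hp.nonneg k
  gcongr

lemma summable_phi (hp : OffspringLaw p σ v) {θ : ℝ} (hθ : θ ≤ σ) :
    Summable fun k : ℕ => p k * (Real.exp (θ * ((k : ℝ) - 1)) - 1) := by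
  have h1 := ((hp.summable_exp hθ).mul_right (Real.exp (-θ))).sub hp.summable
  refine h1.congr fun k => ?_
  rw [mul_assoc, ← Real.exp_add]
  ring_nf

lemma tendsto_phi_div (hp : OffspringLaw p σ v) :
    Tendsto (fun θ => gwPhi p θ / θ) (𝓝[>] 0) (𝓝 (-v)) := by
  have hσ := hp.sigma_pos
  rw [← hp.drift]
  have hev : ∀ᶠ θ in 𝓝[>] (0 : ℝ), 0 < θ ∧ θ ≤ σ / 2 := by
    filter_upwards [Ioc_mem_nhdsGT (half_pos hσ)] with θ h using h
  have key : Tendsto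
      (fun θ => ∑' k : ℕ, p k * (Real.exp (θ * ((k : ℝ) - 1)) - 1) / θ) (𝓝[>] 0)
      (𝓝 (∑' k : ℕ, ((k : ℝ) - 1) * p k)) := by
    refine tendsto_tsum_of_dominated_convergence
      (bound := fun k => (2 / σ * Real.exp σ) * (p k * Real.exp (σ * k)))
      (hp.expMoment.mul_left _) (fun k => ?_) ?_
    · have hd : HasDerivAt (fun θ : ℝ => p k * (Real.exp (θ * ((k : ℝ) - 1)) - 1))
          (((k : ℝ) - 1) * p k) 0 := by
        have h := ((((hasDerivAt_id (0 : ℝ)).mul_const ((k : ℝ) - 1)).exp).sub_const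
          1).const_mul (p k)
        refine h.congr_deriv ?_
        simp [mul_comm]
      have h := hd.tendsto_slope.mono_left
        (nhdsWithin_mono (0 : ℝ) (fun x (hx : (0 : ℝ) < x) => hx.ne'))
      refine h.congr fun θ => ?_
      simp [slope_def_field]
    · filter_upwards [hev] with θ hθ k
      have hk := hp.nonneg k
      set l : ℝ := (k : ℝ) - 1
      have hl : |l| ≤ k + 1 := by
        rw [abs_le]
        have : (0 : ℝ) ≤ k := k.cast_nonneg
        constructor <;> simp only [l] <;> linarith
      have h1 : |Real.exp (θ * l) - 1| ≤ θ * |l| * Real.exp (θ * |l|) := by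
        have h := abs_exp_sub_one_le_mul_exp (θ * l)
        rwa [abs_mul, abs_of_pos hθ.1] at h
      have h2 : |l| ≤ 2 / σ * Real.exp (σ / 2 * |l|) := by
        have := Real.add_one_le_exp (σ / 2 * |l|)
        rw [div_mul_eq_mul_div, le_div_iff₀ hσ]
        linarith
      have h3 : Real.exp (θ * |l|) ≤ Real.exp (σ / 2 * |l|) := by
        have := hθ.2
        gcongr
      have h4 : |l| * Real.exp (θ * |l|) ≤ 2 / σ * Real.exp (σ * (k + 1)) := by
        calc |l| * Real.exp (θ * |l|)
            ≤ (2 / σ * Real.exp (σ / 2 * |l|)) * Real.exp (σ / 2 * |l|) := by gcongr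
          _ = 2 / σ * Real.exp (σ * |l|) := by
              rw [mul_assoc, ← Real.exp_add]; ring_nf
          _ ≤ _ := by gcongr
      have h5 : Real.exp (σ * (k + 1)) = Real.exp σ * Real.exp (σ * k) := by
        rw [← Real.exp_add]; ring_nf
      rw [Real.norm_eq_abs, abs_div, abs_mul, abs_of_nonneg hk, abs_of_pos hθ.1,
        div_le_iff₀ hθ.1]
      calc p k * |Real.exp (θ * l) - 1| ≤ p k * (θ * |l| * Real.exp (θ * |l|)) := by gcongr
        _ = p k * θ * (|l| * Real.exp (θ * |l|)) := by ring
        _ ≤ p k * θ * (2 / σ * Real.exp (σ * (k + 1))) := by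
            have := hθ.1
            gcongr
        _ = _ := by rw [h5]; ring
  refine key.congr fun θ => ?_
  rw [gwPhi, tsum_div_const]

lemma exists_phi_neg (hp : OffspringLaw p σ v) : ∃ θ, 0 < θ ∧ θ ≤ σ ∧ gwPhi p θ < 0 := by
  have h1 := hp.tendsto_phi_div.eventually (gt_mem_nhds (neg_neg_of_pos hp.v_pos))
  obtain ⟨θ, h, hθ⟩ := (h1.and (Ioc_mem_nhdsGT hp.sigma_pos)).exists
  refine ⟨θ, hθ.1, hθ.2, ?_⟩
  by_contra hc
  exact absurd (div_nonneg (not_lt.1 hc) hθ.1.le) (not_le.2 h)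

lemma phi_half_le (hp : OffspringLaw p σ v) {θ : ℝ} (h0 : 0 ≤ θ) (hθ : θ ≤ σ) :
    gwPhi p (θ / 2) ≤ gwPhi p θ / 2 := by
  unfold gwPhi
  rw [← tsum_div_const]
  refine Summable.tsum_le_tsum (fun k => ?_) (hp.summable_phi (by linarith))
    ((hp.summable_phi hθ).div_const 2)
  have h : Real.exp (θ * ((k : ℝ) - 1)) = Real.exp (θ / 2 * ((k : ℝ) - 1)) ^ 2 := by
    rw [← Real.exp_nat_mul]; push_cast; ring_nf
  rw [h, mul_div_assoc]
  refine mul_le_mul_of_nonneg_left ?_ (hp.nonneg k)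
  nlinarith [sq_nonneg (Real.exp (θ / 2 * ((k : ℝ) - 1)) - 1)]

end OffspringLaw

section Generator

variable {p : ℕ → ℝ} {σ v : ℝ}

lemma gwRate_zero_left (p : ℕ → ℝ) (y : ℕ) : gwRate p 0 y = 0 := by simp [gwRate]

lemma gwRate_zero_right (p : ℕ → ℝ) (x : ℕ) : gwRate p x 0 = if x = 1 then p 0 else 0 := by
  unfold gwRate
  by_cases h : x = 1
  · simp [h]
  · rw [if_neg (by omega), if_neg (by omega), if_neg h]

lemma gwRate_term (p g : ℕ → ℝ) {x : ℕ} (hx : 1 ≤ x) (k : ℕ) :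
    (if 1 ≤ x + k - 1 then gwRate p x (x + k - 1) else 0) * (g (x + k - 1) - g x) =
      (x : ℝ) * p k * (if 1 ≤ x + k - 1 then g (x + k - 1) - g x else 0) := by
  by_cases h1 : 1 ≤ x + k - 1
  · rw [if_pos h1, if_pos h1]
    rcases Nat.lt_trichotomy k 1 with hk | hk | hk
    · obtain rfl : k = 0 := by omega
      rw [gwRate, if_pos ⟨hx, by omega⟩]
    · subst hk
      simp
    · rw [gwRate, if_neg (by omega), if_pos ⟨hx, by omega⟩]
      congr 4
      omega
  · rw [if_neg h1, if_neg h1]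
    simp

lemma summable_gwQRefl (hp : OffspringLaw p σ v) {g : ℕ → ℝ} (hg : Bounded g) (x : ℕ) :
    Summable fun k : ℕ =>
      (x : ℝ) * p k * (if 1 ≤ x + k - 1 then g (x + k - 1) - g x else 0) := by
  obtain ⟨C, hC⟩ := hg
  refine Summable.of_norm_bounded ((hp.summable.mul_left (x : ℝ)).mul_right (2 * C))
    fun k => ?_
  have hk := hp.nonneg k
  rw [norm_mul, Real.norm_eq_abs, abs_of_nonneg (by positivity)]
  refine mul_le_mul_of_nonneg_left ?_ (by positivity)
  have h1 := hC x
  have h2 := hC (x + k - 1)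
  split_ifs
  · calc ‖g (x + k - 1) - g x‖ ≤ ‖g (x + k - 1)‖ + ‖g x‖ := norm_sub_le _ _
      _ ≤ 2 * C := by rw [Real.norm_eq_abs, Real.norm_eq_abs]; linarith
  · have := (abs_nonneg _).trans h1
    simpa using this

lemma hasSum_gwRate (hp : OffspringLaw p σ v) {g : ℕ → ℝ} (hg : Bounded g) (x : ℕ) :
    HasSum (fun y : ℕ => (if 1 ≤ y then gwRate p x y else 0) * (g y - g x))
      (gwQRefl p g x) := by
  rcases Nat.eq_zero_or_pos x with rfl | hx
  · simp [gwRate_zero_left, gwQRefl, hasSum_zero]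
  · have hinj : Function.Injective fun k : ℕ => x + k - 1 := by
      intro a b hab
      simp only at hab
      omega
    rw [← hinj.hasSum_iff]
    · have h := (summable_gwQRefl hp hg x).hasSum
      refine h.congr_fun ?_
      intro k
      exact gwRate_term p g hx k
    · intro y hy
      have hy' : y + 1 < x := by
        by_contra hc
        exact hy ⟨y + 1 - x, by simp only; omega⟩
      have h0 : gwRate p x y = 0 := by
        rw [gwRate, if_neg (by omega), if_neg (by omega)]
      simp [h0]

lemma sum_update_sub {N : ℕ} (g : ℕ → ℝ) (ξ : Fin N → ℕ) (i : Fin N) (y : ℕ) :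
    ∑ j, g (Function.update ξ i y j) - ∑ j, g (ξ j) = g y - g (ξ i) := by
  rw [← Finset.sum_sub_distrib, Finset.sum_eq_single i]
  · simp
  · intro j _ hj
    simp [Function.update_of_ne hj]
  · simp

/-- Action of the Fleming-Viot generator on additive observables. -/
lemma fvGen_sum (hp : OffspringLaw p σ v) {g : ℕ → ℝ} (hg : Bounded g) (N : ℕ)
    (ξ : Fin N → ℕ) :
    fvGen p N (fun η => ∑ j, g (η j)) ξ =
      ∑ i, (gwQRefl p g (ξ i) + gwRate p (ξ i) 0 * ((N : ℝ) / ((N : ℝ) - 1)) *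
        ((N : ℝ)⁻¹ * ∑ j, if 1 ≤ ξ j then g (ξ j) - g (ξ i) else 0)) := by
  unfold fvGen fvGenQ
  refine Finset.sum_congr rfl fun i _ => ?_
  set a : ℝ := gwRate p (ξ i) 0 * ((N : ℝ) / ((N : ℝ) - 1))
  have h1 := hasSum_gwRate hp hg (ξ i)
  have h2 : HasSum (fun y : ℕ => a * ((N : ℝ)⁻¹ *
      ∑ j, if y = ξ j then (if 1 ≤ ξ j then g (ξ j) - g (ξ i) else 0) else 0))
      (a * ((N : ℝ)⁻¹ * ∑ j, if 1 ≤ ξ j then g (ξ j) - g (ξ i) else 0)) :=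
    ((hasSum_sum fun j _ => hasSum_ite_eq (ξ j) _).mul_left _).mul_left _
  rw [← (h1.add h2).tsum_eq]
  refine tsum_congr fun y => ?_
  rw [sum_update_sub]
  by_cases hy : 1 ≤ y
  · have : ∑ j, (if y = ξ j then (if 1 ≤ ξ j then g (ξ j) - g (ξ i) else 0) else 0) =
        (∑ j, if ξ j = y then (1 : ℝ) else 0) * (g y - g (ξ i)) := by
      rw [Finset.sum_mul]
      refine Finset.sum_congr rfl fun j _ => ?_
      by_cases h : ξ j = y
      · simp [h, hy]
      · simp [h, Ne.symm h]
    rw [this, if_pos hy, if_pos hy, emp]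
    ring
  · have : ∑ j, (if y = ξ j then (if 1 ≤ ξ j then g (ξ j) - g (ξ i) else 0) else 0) = 0 := by
      refine Finset.sum_eq_zero fun j _ => ?_
      split_ifs with h h' <;> first | rfl | omega
    rw [this, if_neg hy, if_neg hy]
    ring

lemma bounded_capExp {θ : ℝ} (hθ : 0 ≤ θ) (M : ℕ) : Bounded (capExp θ M) :=
  ⟨Real.exp (θ * M), fun x => by
    rw [abs_of_pos (capExp_pos _ _ _)]; exact capExp_le hθ M x⟩

lemma gwQRefl_capExp_of_lt (p : ℕ → ℝ) (θ : ℝ) {M x : ℕ} (h : M < x) :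
    gwQRefl p (capExp θ M) x = 0 := by
  have : ∀ k : ℕ, capExp θ M (x + k - 1) - capExp θ M x = 0 := fun k => by
    rw [capExp_of_ge (by omega), capExp_of_ge h.le, sub_self]
  simp [gwQRefl, this]

lemma gwQRefl_capExp_le (hp : OffspringLaw p σ v) {θ : ℝ} (hθ : 0 ≤ θ) (hθσ : θ ≤ σ)
    {M x : ℕ} (h : x ≤ M) :
    gwQRefl p (capExp θ M) x ≤
      x * capExp θ M x * gwPhi p θ + p 0 * capExp θ M x := by
  rcases Nat.eq_zero_or_pos x with rfl | hx
  · have := hp.nonneg 0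
    have := (capExp_pos θ M 0).le
    simp only [gwQRefl, Nat.cast_zero, zero_mul, tsum_zero, zero_add]
    positivity
  have hs := ((hp.summable_phi hθσ).hasSum.mul_left (x * capExp θ M x)).add
    (hasSum_ite_eq (0 : ℕ) (p 0 * capExp θ M x))
  refine hasSum_le (fun k => ?_)
    (summable_gwQRefl hp (bounded_capExp hθ M) x).hasSum hs
  have hk := hp.nonneg k
  have hg := (capExp_pos θ M x).le
  have hx1 : (1 : ℝ) ≤ x := by exact_mod_cast hx
  have hmain : 1 ≤ x + k - 1 → capExp θ M (x + k - 1) - capExp θ M x ≤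
      capExp θ M x * (Real.exp (θ * ((k : ℝ) - 1)) - 1) := by
    intro h1
    have h2 := capExp_le_exp hθ M (x + k - 1)
    have h3 : Real.exp (θ * ((x + k - 1 : ℕ) : ℝ)) =
        capExp θ M x * Real.exp (θ * ((k : ℝ) - 1)) := by
      rw [capExp_of_le h, ← Real.exp_add, Nat.cast_sub (by omega)]
      push_cast
      ring_nf
    rw [h3] at h2
    linarith
  have hextra : 0 ≤ if k = 0 then p 0 * capExp θ M x else 0 := by
    have := hp.nonneg 0
    split_ifs <;> positivity
  by_cases h1 : 1 ≤ x + k - 1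
  · rw [if_pos h1]
    have := mul_le_mul_of_nonneg_left (hmain h1) (by positivity : 0 ≤ (x : ℝ) * p k)
    linarith
  · obtain ⟨rfl, rfl⟩ : x = 1 ∧ k = 0 := by omega
    rw [if_neg h1, if_pos rfl]
    have h2 : 0 ≤ p 0 * capExp θ M 1 * Real.exp (θ * (((0 : ℕ) : ℝ) - 1)) := by positivity
    push_cast at h2 ⊢
    linarith

lemma le_gwQRefl_capExp (hp : OffspringLaw p σ v) {θ : ℝ} (hθ : 0 ≤ θ) (M x : ℕ) :
    -(M * p 0 * Real.exp (θ * M)) ≤ gwQRefl p (capExp θ M) x := by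
  have hp0 := hp.nonneg 0
  rcases lt_or_ge M x with h | h
  · rw [gwQRefl_capExp_of_lt p θ h]
    have : 0 ≤ M * p 0 * Real.exp (θ * M) := by positivity
    linarith
  refine hasSum_le (fun k => ?_) (hasSum_ite_eq (0 : ℕ) (-(M * p 0 * Real.exp (θ * M))))
    (summable_gwQRefl hp (bounded_capExp hθ M) x).hasSum
  have hk := hp.nonneg k
  rcases Nat.eq_zero_or_pos k with rfl | hk0
  · rw [if_pos rfl]
    have hxM : (x : ℝ) ≤ M := by exact_mod_cast h
    have h1 : x * p 0 * Real.exp (θ * M) ≤ M * p 0 * Real.exp (θ * M) := by gcongr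
    have h2 : -Real.exp (θ * M) ≤ (if 1 ≤ x + 0 - 1 then
        capExp θ M (x + 0 - 1) - capExp θ M x else 0) := by
      have := capExp_le hθ M x
      have := (capExp_pos θ M (x + 0 - 1)).le
      have := Real.exp_pos (θ * M)
      split_ifs <;> linarith
    have h3 := mul_le_mul_of_nonneg_left h2 (by positivity : 0 ≤ (x : ℝ) * p 0)
    linarith
  · rw [if_neg hk0.ne']
    have h2 := capExp_mono hθ M (by omega : x ≤ x + k - 1)
    refine mul_nonneg (by positivity) ?_
    split_ifs
    · linarith
    · rfl

lemma selection_factor_le_two (N : ℕ) : (N : ℝ) / ((N : ℝ) - 1) ≤ 2 := by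
  rcases Nat.lt_or_ge N 2 with h | h
  · interval_cases N <;> norm_num
  · have : (2 : ℝ) ≤ N := by exact_mod_cast h
    rw [div_le_iff₀ (by linarith)]
    linarith

lemma selection_factor_nonneg (N : ℕ) : 0 ≤ (N : ℝ) / ((N : ℝ) - 1) := by
  rcases Nat.eq_zero_or_pos N with rfl | h
  · simp
  · have : (1 : ℝ) ≤ N := by exact_mod_cast h
    exact div_nonneg (by linarith) (by linarith)

lemma le_fvGen_capSum (hp : OffspringLaw p σ v) {θ : ℝ} (hθ : 0 ≤ θ) (M N : ℕ)
    (ξ : Fin N → ℕ) :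
    -(N * (M * p 0 * Real.exp (θ * M))) ≤ fvGen p N (capSum θ M N) ξ := by
  have h := fvGen_sum hp (bounded_capExp hθ M) N ξ
  change fvGen p N (capSum θ M N) ξ = _ at h
  rw [h]
  calc -(N * (M * p 0 * Real.exp (θ * M)))
      = ∑ _i : Fin N, -(M * p 0 * Real.exp (θ * M)) := by simp
    _ ≤ _ := by
      refine Finset.sum_le_sum fun i _ => ?_
      have h1 := le_gwQRefl_capExp hp hθ M (ξ i)
      have h2 : 0 ≤ gwRate p (ξ i) 0 * ((N : ℝ) / ((N : ℝ) - 1)) * ((N : ℝ)⁻¹ *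
          ∑ j, if 1 ≤ ξ j then capExp θ M (ξ j) - capExp θ M (ξ i) else 0) := by
        rw [gwRate_zero_right]
        split_ifs with hi
        · refine mul_nonneg (mul_nonneg (hp.nonneg 0) (selection_factor_nonneg N))
            (mul_nonneg (by positivity) (Finset.sum_nonneg fun j _ => ?_))
          split_ifs with hj
          · exact sub_nonneg.2 (capExp_mono hθ M (by omega))
          · rfl
        · simp
      linarith

lemma fvGen_capSum_le (hp : OffspringLaw p σ v) {θ : ℝ} (hθ : 0 ≤ θ) (hθσ : θ ≤ σ)
    (M N : ℕ) (ξ : Fin N → ℕ) :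
    fvGen p N (capSum θ M N) ξ ≤ ∑ i, (3 * p 0 * capExp θ M (ξ i) +
      if ξ i ≤ M then ξ i * capExp θ M (ξ i) * gwPhi p θ else 0) := by
  have h := fvGen_sum hp (bounded_capExp hθ M) N ξ
  change fvGen p N (capSum θ M N) ξ = _ at h
  have hp0 := hp.nonneg 0
  have hS : 0 ≤ ∑ j, capExp θ M (ξ j) :=
    Finset.sum_nonneg fun j _ => (capExp_pos _ _ _).le
  have hsel : ∀ i, gwRate p (ξ i) 0 * ((N : ℝ) / ((N : ℝ) - 1)) * ((N : ℝ)⁻¹ *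
      ∑ j, if 1 ≤ ξ j then capExp θ M (ξ j) - capExp θ M (ξ i) else 0) ≤
      p 0 * 2 * ((N : ℝ)⁻¹ * ∑ j, capExp θ M (ξ j)) := by
    intro i
    rw [gwRate_zero_right]
    split_ifs with hi
    · have h1 := selection_factor_nonneg N
      have h2 := selection_factor_le_two N
      have h3 : ∑ j, (if 1 ≤ ξ j then capExp θ M (ξ j) - capExp θ M (ξ i) else 0) ≤
          ∑ j, capExp θ M (ξ j) := by
        refine Finset.sum_le_sum fun j _ => ?_
        have := capExp_pos θ M (ξ i)
        have := capExp_pos θ M (ξ j)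
        split_ifs <;> linarith
      calc _ ≤ p 0 * ((N : ℝ) / ((N : ℝ) - 1)) * ((N : ℝ)⁻¹ * ∑ j, capExp θ M (ξ j)) := by
            gcongr
        _ ≤ _ := by gcongr
    · rw [zero_mul, zero_mul]
      positivity
  have hjump : ∀ i, gwQRefl p (capExp θ M) (ξ i) ≤ p 0 * capExp θ M (ξ i) +
      if ξ i ≤ M then ξ i * capExp θ M (ξ i) * gwPhi p θ else 0 := by
    intro i
    split_ifs with hi
    · linarith [gwQRefl_capExp_le hp hθ hθσ hi]
    · rw [gwQRefl_capExp_of_lt p θ (not_le.1 hi)]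
      have := (capExp_pos θ M (ξ i)).le
      positivity
  have hN : ∑ _i : Fin N, p 0 * 2 * ((N : ℝ)⁻¹ * ∑ j, capExp θ M (ξ j)) =
      p 0 * 2 * ∑ j, capExp θ M (ξ j) := by
    rcases Nat.eq_zero_or_pos N with rfl | hN
    · simp
    · have : (N : ℝ) ≠ 0 := by positivity
      rw [Finset.sum_const, Finset.card_univ, Fintype.card_fin, nsmul_eq_mul]
      field_simp
  rw [h]
  calc _ ≤ ∑ i, ((p 0 * capExp θ M (ξ i) +
        if ξ i ≤ M then ξ i * capExp θ M (ξ i) * gwPhi p θ else 0) +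
        p 0 * 2 * ((N : ℝ)⁻¹ * ∑ j, capExp θ M (ξ j))) :=
        Finset.sum_le_sum fun i _ => add_le_add (hjump i) (hsel i)
    _ = _ := by
      rw [Finset.sum_add_distrib, hN, Finset.mul_sum, ← Finset.sum_add_distrib]
      refine Finset.sum_congr rfl fun i _ => ?_
      ring

lemma capSum_nonneg (θ : ℝ) (M N : ℕ) (ξ : Fin N → ℕ) : 0 ≤ capSum θ M N ξ :=
  Finset.sum_nonneg fun _ _ => (capExp_pos _ _ _).le

lemma capSum_le {θ : ℝ} (hθ : 0 ≤ θ) (M N : ℕ) (ξ : Fin N → ℕ) :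
    capSum θ M N ξ ≤ N * Real.exp (θ * M) := by
  calc capSum θ M N ξ ≤ ∑ _i : Fin N, Real.exp (θ * M) :=
        Finset.sum_le_sum fun i _ => capExp_le hθ M _
    _ = _ := by simp

lemma capSum_le_rmax {θ : ℝ} (hθ : 0 ≤ θ) (M N : ℕ) (ξ : Fin N → ℕ) :
    capSum θ M N ξ ≤ N * Real.exp (θ * rmax N ξ) := by
  calc capSum θ M N ξ ≤ ∑ _i : Fin N, Real.exp (θ * rmax N ξ) := by
        refine Finset.sum_le_sum fun i _ => (capExp_le_exp hθ M _).trans ?_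
        have : ξ i ≤ rmax N ξ := Finset.le_sup (f := ξ) (Finset.mem_univ i)
        gcongr
    _ = _ := by simp

/-- Exponential growth of the frozen exponential sum. -/
lemma fvGen_capSum_le_mul (hp : OffspringLaw p σ v) {θ : ℝ} (hθ : 0 ≤ θ) (hθσ : θ ≤ σ)
    (hφ : gwPhi p θ ≤ 0) (M N : ℕ) (ξ : Fin N → ℕ) :
    fvGen p N (capSum θ M N) ξ ≤ 3 * p 0 * capSum θ M N ξ := by
  refine (fvGen_capSum_le hp hθ hθσ M N ξ).trans ?_
  rw [capSum, Finset.mul_sum]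
  refine Finset.sum_le_sum fun i _ => ?_
  have := mul_nonpos_of_nonneg_of_nonpos
    (mul_nonneg (ξ i).cast_nonneg (capExp_pos θ M (ξ i)).le) hφ
  split_ifs <;> linarith

/-- Drift of the frozen exponential sum at an arbitrary rate `l`, up to a constant and a
remainder controlled by a larger exponent. -/
lemma fvGen_capSum_le_drift (hp : OffspringLaw p σ v) {θ θ' κ l : ℝ} (hθ : 0 ≤ θ)
    (hθσ : θ ≤ σ) (hκ : 0 < κ) (hφ : gwPhi p θ ≤ -κ) (hl : 0 ≤ l) (M N : ℕ)
    (ξ : Fin N → ℕ) :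
    fvGen p N (capSum θ M N) ξ ≤ -l * capSum θ M N ξ +
      (N * ((3 * p 0 + l) * Real.exp (θ * ((3 * p 0 + l) / κ))) +
      (3 * p 0 + l) * Real.exp (-(θ' - θ) * M) * capSum θ' M N ξ) := by
  have hp0 := hp.nonneg 0
  set c := 3 * p 0
  have hc : 0 ≤ c := by positivity
  refine (fvGen_capSum_le hp hθ hθσ M N ξ).trans ?_
  have hterm : ∀ i, c * capExp θ M (ξ i) +
      (if ξ i ≤ M then ξ i * capExp θ M (ξ i) * gwPhi p θ else 0) ≤
      -l * capExp θ M (ξ i) + ((c + l) * Real.exp (θ * ((c + l) / κ)) +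
        (c + l) * Real.exp (-(θ' - θ) * M) * capExp θ' M (ξ i)) := by
    intro i
    have hE := (capExp_pos θ M (ξ i)).le
    have hE' := (capExp_pos θ' M (ξ i)).le
    have hpos1 : 0 ≤ (c + l) * Real.exp (θ * ((c + l) / κ)) := by positivity
    have hpos2 : 0 ≤ (c + l) * Real.exp (-(θ' - θ) * M) * capExp θ' M (ξ i) := by positivity
    split_ifs with hi
    · have h1 := mul_le_mul_of_nonneg_left hφ
        (mul_nonneg (ξ i).cast_nonneg hE : 0 ≤ (ξ i : ℝ) * capExp θ M (ξ i))
      have h2 : (c + l - κ * ξ i) * capExp θ M (ξ i) ≤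
          (c + l) * Real.exp (θ * ((c + l) / κ)) := by
        rcases le_total (c + l) (κ * ξ i) with h | h
        · exact (mul_nonpos_of_nonpos_of_nonneg (by linarith) hE).trans hpos1
        · have h3 : (ξ i : ℝ) ≤ (c + l) / κ := by
            rw [le_div_iff₀ hκ]; linarith
          have h4 : 0 ≤ κ * ξ i := by positivity
          have h5 : capExp θ M (ξ i) ≤ Real.exp (θ * ((c + l) / κ)) := by
            rw [capExp_of_le hi]; gcongr
          exact mul_le_mul (by linarith) h5 hE (by positivity)
      linarith
    · have hM := (not_le.1 hi).le
      have h1 : capExp θ M (ξ i) = Real.exp (-(θ' - θ) * M) * capExp θ' M (ξ i) := by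
        rw [capExp_of_ge hM, capExp_of_ge hM, ← Real.exp_add]
        ring_nf
      have h2 : (c + l) * capExp θ M (ξ i) =
          (c + l) * Real.exp (-(θ' - θ) * M) * capExp θ' M (ξ i) := by rw [h1]; ring
      linarith
  refine (Finset.sum_le_sum fun i _ => hterm i).trans_eq ?_
  simp only [Finset.sum_add_distrib, ← Finset.mul_sum, capSum, Finset.sum_const,
    Finset.card_univ, Fintype.card_fin, nsmul_eq_mul]
  ring

end Generator

/-- Linear differential inequality on an interval. -/
lemma le_of_hasDerivWithinAt_le_linear {F F' : ℝ → ℝ} {l D T : ℝ} (hl : l ≠ 0) (hT : 0 ≤ T)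
    (hF : ∀ t, 0 ≤ t → HasDerivWithinAt F (F' t) (Ici 0) t)
    (hle : ∀ t ∈ Icc 0 T, F' t ≤ -l * F t + D) :
    F T ≤ Real.exp (-l * T) * F 0 + D / l * (1 - Real.exp (-l * T)) := by
  have hG : ∀ t, 0 ≤ t → HasDerivWithinAt (fun t => Real.exp (l * t) * (F t - D / l))
      (Real.exp (l * t) * l * (F t - D / l) + Real.exp (l * t) * F' t) (Ici 0) t := by
    intro t ht
    have h1 : HasDerivAt (fun t : ℝ => Real.exp (l * t)) (Real.exp (l * t) * l) t := by
      simpa using ((hasDerivAt_id t).const_mul l).exp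
    exact h1.hasDerivWithinAt.mul ((hF t ht).sub_const _)
  have hanti : AntitoneOn (fun t => Real.exp (l * t) * (F t - D / l)) (Icc 0 T) := by
    refine antitoneOn_of_hasDerivWithinAt_nonpos (convex_Icc 0 T)
      (fun t ht => ((hG t ht.1).mono Icc_subset_Ici_self).continuousWithinAt)
      (f' := fun t => Real.exp (l * t) * l * (F t - D / l) + Real.exp (l * t) * F' t)
      (fun t ht => ?_) (fun t ht => ?_)
    · have ht' := interior_subset ht
      exact (hG t ht'.1).mono (interior_subset.trans Icc_subset_Ici_self)
    · have h1 := hle t (interior_subset ht)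
      have h2 := mul_le_mul_of_nonneg_left h1 (Real.exp_pos (l * t)).le
      have h3 : Real.exp (l * t) * l * (F t - D / l) =
          Real.exp (l * t) * (l * F t - D) := by field_simp
      rw [h3]
      linarith
  have h := hanti (left_mem_Icc.2 hT) (right_mem_Icc.2 hT) hT
  simp only [mul_zero, Real.exp_zero, one_mul] at h
  have hprod : Real.exp (-l * T) * Real.exp (l * T) = 1 := by
    rw [← Real.exp_add]; simp
  have h2 := mul_le_mul_of_nonneg_left h (Real.exp_pos (-l * T)).le
  rw [← mul_assoc, hprod] at h2
  linarith

section Semigroup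

variable {p : ℕ → ℝ} {σ v : ℝ} {N : ℕ} {K : MarkovSemigroup (Fin N → ℕ)}

lemma integrable_of_bounded (K : MarkovSemigroup (Fin N → ℕ)) (t : ℝ) (ξ : Fin N → ℕ)
    {f : (Fin N → ℕ) → ℝ} {C : ℝ} (hf : ∀ η, |f η| ≤ C) : Integrable f (K.P t ξ) := by
  have := K.prob t ξ
  exact Integrable.of_bound (Measurable.of_discrete).aestronglyMeasurable C
    (Eventually.of_forall hf)

lemma integrable_capSum (K : MarkovSemigroup (Fin N → ℕ)) (t : ℝ) (ξ : Fin N → ℕ)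
    {θ : ℝ} (hθ : 0 ≤ θ) (M : ℕ) : Integrable (capSum θ M N) (K.P t ξ) :=
  integrable_of_bounded K t ξ fun η => by
    rw [abs_of_nonneg (capSum_nonneg _ _ _ _)]; exact capSum_le hθ M N η

lemma integrable_fvGen_capSum (hp : OffspringLaw p σ v) (t : ℝ) (ξ : Fin N → ℕ)
    {θ : ℝ} (hθ : 0 ≤ θ) (hθσ : θ ≤ σ) (hφ : gwPhi p θ ≤ 0) (M : ℕ) :
    Integrable (fvGen p N (capSum θ M N)) (K.P t ξ) := by
  have hp0 := hp.nonneg 0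
  refine integrable_of_bounded K t ξ
    (C := N * (M * p 0 * Real.exp (θ * M)) + 3 * p 0 * (N * Real.exp (θ * M))) fun η => ?_
  have h1 := le_fvGen_capSum hp hθ M N η
  have h2 := fvGen_capSum_le_mul hp hθ hθσ hφ M N η
  have h3 := mul_le_mul_of_nonneg_left (capSum_le hθ M N η) (by positivity : 0 ≤ 3 * p 0)
  have h4 : 0 ≤ N * (M * p 0 * Real.exp (θ * M)) := by positivity
  have h5 : 0 ≤ 3 * p 0 * (N * Real.exp (θ * M)) := by positivity
  rw [abs_le]
  constructor <;> linarith

lemma hasDerivWithinAt_capSum (hK : IsFVSemigroup p N K) {θ : ℝ} (hθ : 0 ≤ θ) (M : ℕ)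
    (ξ : Fin N → ℕ) (t : ℝ) (ht : 0 ≤ t) :
    HasDerivWithinAt (fun u => ∫ η, capSum θ M N η ∂ K.P u ξ)
      (∫ η, fvGen p N (capSum θ M N) η ∂ K.P t ξ) (Ici 0) t :=
  hK _ ⟨N * Real.exp (θ * M), fun η => by
    rw [abs_of_nonneg (capSum_nonneg _ _ _ _)]; exact capSum_le hθ M N η⟩
    Measurable.of_discrete ξ t ht

lemma integral_capSum_zero (K : MarkovSemigroup (Fin N → ℕ)) (θ : ℝ) (M : ℕ)
    (ξ : Fin N → ℕ) : ∫ η, capSum θ M N η ∂ K.P 0 ξ = capSum θ M N ξ := by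
  rw [K.init, integral_dirac]

lemma integral_capSum_le_exp (hp : OffspringLaw p σ v) (hK : IsFVSemigroup p N K) {θ : ℝ}
    (hθ : 0 ≤ θ) (hθσ : θ ≤ σ) (hφ : gwPhi p θ ≤ 0) (M : ℕ) (ξ : Fin N → ℕ) {t : ℝ}
    (ht : 0 ≤ t) :
    ∫ η, capSum θ M N η ∂ K.P t ξ ≤
      Real.exp ((3 * p 0 + 1) * t) * (N * Real.exp (θ * rmax N ξ)) := by
  have hp0 := hp.nonneg 0
  have h := le_of_hasDerivWithinAt_le_linear (l := -(3 * p 0 + 1)) (D := 0)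
    (by linarith) ht
    (hasDerivWithinAt_capSum hK hθ M ξ) fun s _ => ?_
  · rw [integral_capSum_zero] at h
    have h2 := mul_le_mul_of_nonneg_left (capSum_le_rmax hθ M N ξ)
      (Real.exp_pos ((3 * p 0 + 1) * t)).le
    simp only [neg_neg, zero_div, zero_mul, add_zero] at h
    exact h.trans h2
  · have h1 : ∫ η, fvGen p N (capSum θ M N) η ∂ K.P s ξ ≤
        ∫ η, 3 * p 0 * capSum θ M N η ∂ K.P s ξ :=
      integral_mono (integrable_fvGen_capSum hp s ξ hθ hθσ hφ M)
        ((integrable_capSum K s ξ hθ M).const_mul _)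
        fun η => fvGen_capSum_le_mul hp hθ hθσ hφ M N η
    rw [integral_const_mul] at h1
    have h2 : 0 ≤ ∫ η, capSum θ M N η ∂ K.P s ξ :=
      integral_nonneg fun η => capSum_nonneg _ _ _ _
    linarith

lemma integral_capSum_le_drift (hp : OffspringLaw p σ v) (hK : IsFVSemigroup p N K)
    {θ θ' κ l T : ℝ} (hθ : 0 ≤ θ) (hθσ : θ ≤ σ) (hκ : 0 < κ) (hφ : gwPhi p θ ≤ -κ)
    (hθ' : 0 ≤ θ') (hθσ' : θ' ≤ σ) (hφ' : gwPhi p θ' ≤ 0)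
    (hl : 0 < l) (hT : 0 ≤ T) (M : ℕ) (ξ : Fin N → ℕ) :
    ∫ η, capSum θ M N η ∂ K.P T ξ ≤
      Real.exp (-l * T) * (N * Real.exp (θ * rmax N ξ)) +
      (N * ((3 * p 0 + l) * Real.exp (θ * ((3 * p 0 + l) / κ))) +
        (3 * p 0 + l) * Real.exp (-(θ' - θ) * M) *
          (Real.exp ((3 * p 0 + 1) * T) * (N * Real.exp (θ' * rmax N ξ)))) / l := by
  have hp0 := hp.nonneg 0
  set D := N * ((3 * p 0 + l) * Real.exp (θ * ((3 * p 0 + l) / κ))) +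
        (3 * p 0 + l) * Real.exp (-(θ' - θ) * M) *
          (Real.exp ((3 * p 0 + 1) * T) * (N * Real.exp (θ' * rmax N ξ))) with hD
  have hD0 : 0 ≤ D := by positivity
  have h := le_of_hasDerivWithinAt_le_linear (l := l) (D := D) hl.ne' hT
    (hasDerivWithinAt_capSum hK hθ M ξ) fun s hs => ?_
  · rw [integral_capSum_zero] at h
    have h2 := mul_le_mul_of_nonneg_left (capSum_le_rmax hθ M N ξ) (Real.exp_pos (-l * T)).le
    have h3 : D / l * (1 - Real.exp (-l * T)) ≤ D / l * 1 := by
      refine mul_le_mul_of_nonneg_left ?_ (by positivity)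
      linarith [Real.exp_pos (-l * T)]
    linarith
  · have := K.prob s ξ
    have i1 := integrable_capSum K s ξ hθ M
    have i2 := integrable_capSum K s ξ hθ' M
    have h1 := integral_mono (integrable_fvGen_capSum hp s ξ hθ hθσ (by linarith) M)
      ((i1.const_mul (-l)).add ((integrable_const _).add (i2.const_mul _)))
      fun η => fvGen_capSum_le_drift hp (θ' := θ') hθ hθσ hκ hφ hl.le M N η
    have h2 := integral_capSum_le_exp hp hK hθ' hθσ' hφ' M ξ hs.1
    have h3 : Real.exp ((3 * p 0 + 1) * s) * (N * Real.exp (θ' * rmax N ξ)) ≤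
        Real.exp ((3 * p 0 + 1) * T) * (N * Real.exp (θ' * rmax N ξ)) := by
      have := hs.2
      gcongr
    refine h1.trans ?_
    rw [integral_add' (i1.const_mul _) ((integrable_const _).add (i2.const_mul _)),
      integral_add' (integrable_const _) (i2.const_mul _), integral_const, hD]
    simp only [integral_const_mul, probReal_univ, one_smul]
    have h4 := mul_le_mul_of_nonneg_left (h2.trans h3)
      (by positivity : 0 ≤ (3 * p 0 + l) * Real.exp (-(θ' - θ) * M))
    linarith

lemma capExp_rmax_le_capSum (hN : 1 ≤ N) (θ : ℝ) (M : ℕ) (ξ : Fin N → ℕ) :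
    capExp θ M (rmax N ξ) ≤ capSum θ M N ξ := by
  obtain ⟨i, -, hi⟩ := Finset.exists_mem_eq_sup Finset.univ ⟨⟨0, hN⟩, Finset.mem_univ _⟩ ξ
  rw [rmax, hi]
  exact Finset.single_le_sum (f := fun j => capExp θ M (ξ j))
    (fun j _ => (capExp_pos _ _ _).le) (Finset.mem_univ i)

/-- Monotone passage to the limit in the truncation level. -/
lemma integral_exp_rmax_le (hN : 1 ≤ N) (T : ℝ) (ξ : Fin N → ℕ) {θ B : ℝ} (hθ : 0 ≤ θ)
    {u : ℕ → ℝ} (hu : Tendsto u atTop (𝓝 B))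
    (hle : ∀ M, ∫ η, capSum θ M N η ∂ K.P T ξ ≤ u M) :
    Integrable (fun η => Real.exp (θ * rmax N η)) (K.P T ξ) ∧
      ∫ η, Real.exp (θ * rmax N η) ∂ K.P T ξ ≤ B := by
  have h1 : ∀ M, ∫⁻ η, ENNReal.ofReal (capExp θ M (rmax N η)) ∂ K.P T ξ ≤
      ENNReal.ofReal (u M) := by
    intro M
    have hint : Integrable (fun η => capExp θ M (rmax N η)) (K.P T ξ) :=
      integrable_of_bounded K T ξ (C := Real.exp (θ * M)) fun η => by
        rw [abs_of_pos (capExp_pos _ _ _)]; exact capExp_le hθ M _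
    rw [← ofReal_integral_eq_lintegral_ofReal hint
      (Eventually.of_forall fun η => (capExp_pos _ _ _).le)]
    exact ENNReal.ofReal_le_ofReal ((integral_mono hint (integrable_capSum K T ξ hθ M)
      fun η => capExp_rmax_le_capSum hN θ M η).trans (hle M))
  have h2 : Tendsto (fun M => ∫⁻ η, ENNReal.ofReal (capExp θ M (rmax N η)) ∂ K.P T ξ) atTop
      (𝓝 (∫⁻ η, ENNReal.ofReal (Real.exp (θ * rmax N η)) ∂ K.P T ξ)) := by
    refine lintegral_tendsto_of_tendsto_of_monotone
      (fun M => (Measurable.of_discrete).aemeasurable)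
      (Eventually.of_forall fun η M M' h => ENNReal.ofReal_le_ofReal ?_)
      (Eventually.of_forall fun η => tendsto_const_nhds.congr' ?_)
    · unfold capExp
      gcongr
    · filter_upwards [eventually_ge_atTop (rmax N η)] with M hM
      rw [capExp_of_le hM]
  have h3 : ∫⁻ η, ENNReal.ofReal (Real.exp (θ * rmax N η)) ∂ K.P T ξ ≤ ENNReal.ofReal B :=
    le_of_tendsto_of_tendsto' h2 (ENNReal.tendsto_ofReal hu) h1
  have hB : 0 ≤ B := ge_of_tendsto' hu fun M =>
    (integral_nonneg fun η => capSum_nonneg _ _ _ _).trans (hle M)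
  have hm : AEStronglyMeasurable (fun η => Real.exp (θ * rmax N η)) (K.P T ξ) :=
    (Measurable.of_discrete).aestronglyMeasurable
  have hnn : 0 ≤ᵐ[K.P T ξ] fun η => Real.exp (θ * rmax N η) :=
    Eventually.of_forall fun η => (Real.exp_pos _).le
  refine ⟨⟨hm, (hasFiniteIntegral_iff_ofReal hnn).2 (h3.trans_lt ENNReal.ofReal_lt_top)⟩, ?_⟩
  rw [integral_eq_lintegral_of_nonneg_ae hnn hm]
  exact ENNReal.toReal_le_of_le_ofReal hB h3

/-- After time `3θ/κ` the exponential moment of exponent `θ` of the rightmost particle is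
bounded by `N` times the initial exponential of exponent `θ/4`. -/
lemma integral_exp_rmax_le_quarter (hp : OffspringLaw p σ v) (hK : IsFVSemigroup p N K)
    {θ θ' κ : ℝ} (hθ : 0 < θ) (hθσ : θ ≤ σ) (hκ : 0 < κ) (hφ : gwPhi p θ ≤ -κ)
    (hθθ' : θ < θ') (hθσ' : θ' ≤ σ) (hφ' : gwPhi p θ' ≤ 0) (hN : 1 ≤ N)
    (ξ : Fin N → ℕ) (hR : 1 ≤ rmax N ξ) :
    Integrable (fun η => Real.exp (θ * rmax N η)) (K.P (3 * θ / κ) ξ) ∧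
      ∫ η, Real.exp (θ * rmax N η) ∂ K.P (3 * θ / κ) ξ ≤
        N * (1 + (3 * p 0 + κ / 4) / (κ / 4) * Real.exp (θ * (3 * p 0 / κ))) *
          Real.exp (θ / 4 * rmax N ξ) := by
  have hp0 := hp.nonneg 0
  have hR' : (1 : ℝ) ≤ rmax N ξ := by exact_mod_cast hR
  set R : ℝ := (rmax N ξ : ℝ)
  set l : ℝ := κ / 4 * R with hl_def
  have hl : 0 < l := by positivity
  have hT : 0 ≤ 3 * θ / κ := by positivity
  have key := integral_exp_rmax_le (K := K) hN (3 * θ / κ) ξ hθ.le (B :=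
    Real.exp (-l * (3 * θ / κ)) * (N * Real.exp (θ * R)) +
      (N * ((3 * p 0 + l) * Real.exp (θ * ((3 * p 0 + l) / κ))) +
        (3 * p 0 + l) * 0 *
          (Real.exp ((3 * p 0 + 1) * (3 * θ / κ)) * (N * Real.exp (θ' * R)))) / l) ?_
    (fun M => integral_capSum_le_drift hp hK hθ.le hθσ hκ hφ (by linarith) hθσ' hφ' hl hT M ξ)
  · refine ⟨key.1, key.2.trans ?_⟩
    have e1 : Real.exp (-l * (3 * θ / κ)) * (N * Real.exp (θ * R)) =
        N * Real.exp (θ / 4 * R) := by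
      rw [mul_left_comm, ← Real.exp_add]
      congr 2
      rw [hl_def]
      field_simp
      ring
    have e2 : Real.exp (θ * ((3 * p 0 + l) / κ)) =
        Real.exp (θ * (3 * p 0 / κ)) * Real.exp (θ / 4 * R) := by
      rw [← Real.exp_add]
      congr 1
      rw [hl_def]
      field_simp
    have e3 : (3 * p 0 + l) / l ≤ (3 * p 0 + κ / 4) / (κ / 4) := by
      rw [div_le_div_iff₀ hl (by positivity), hl_def]
      nlinarith [mul_nonneg (mul_nonneg hp0 hκ.le) (sub_nonneg.2 hR')]
    rw [e1, e2]
    calc _ = N * Real.exp (θ / 4 * R) + (3 * p 0 + l) / l *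
          (N * (Real.exp (θ * (3 * p 0 / κ)) * Real.exp (θ / 4 * R))) := by ring
      _ ≤ N * Real.exp (θ / 4 * R) + (3 * p 0 + κ / 4) / (κ / 4) *
          (N * (Real.exp (θ * (3 * p 0 / κ)) * Real.exp (θ / 4 * R))) := by gcongr
      _ = _ := by ring
  · have h0 : Tendsto (fun M : ℕ => Real.exp (-(θ' - θ) * M)) atTop (𝓝 0) := by
      refine Real.tendsto_exp_atBot.comp ?_
      exact tendsto_natCast_atTop_atTop.const_mul_atTop_of_neg (by linarith)
    exact ((((h0.const_mul _).mul_const _).const_add _).div_const _).const_add _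

end Semigroup

/-- Interpolation between two exponential exponents. -/
lemma exp_le_exp_half_add (r R θ : ℝ) (hθ : 0 < θ) :
    Real.exp (θ / 4 * r) ≤
      Real.exp (θ / 4 * R / 2) + Real.exp (-(3 * θ / 8) * R) * Real.exp (θ * r) := by
  rw [← Real.exp_add]
  rcases le_total r (R / 2) with h | h
  · have : Real.exp (θ / 4 * r) ≤ Real.exp (θ / 4 * R / 2) := by
      rw [mul_div_assoc]
      gcongr
    linarith [Real.exp_pos (-(3 * θ / 8) * R + θ * r)]
  · have : Real.exp (θ / 4 * r) ≤ Real.exp (-(3 * θ / 8) * R + θ * r) := by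
      refine Real.exp_le_exp.2 ?_
      nlinarith
    linarith [Real.exp_pos (θ / 4 * R / 2)]

/-- **Drift inequality for the rightmost Fleming-Viot particle.**
There are a time `T` and positive constants `A, c₁, c₂, C, ρ`, independent of
`N`, such that for every `N ≥ 1` and every initial configuration `ξ`,
`E[exp(ρ R(ξ_T))] - exp(ρ R(ξ)) < -c₁ e^{ρR(ξ)} 1{R(ξ) > A} + N c₂ e^{-C R(ξ)}`. -/
theorem fv_rightmost_lyapunov
    (p : ℕ → ℝ) (σ v : ℝ) (hp : OffspringLaw p σ v)
    (K : ∀ N : ℕ, MarkovSemigroup (Fin N → ℕ))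
    (hK : ∀ N : ℕ, 1 ≤ N → IsFVSemigroup p N (K N)) :
    ∃ T A c₁ c₂ C ρ : ℝ, 0 < T ∧ 0 < A ∧ 0 < c₁ ∧ 0 < c₂ ∧ 0 < C ∧ 0 < ρ ∧
      ∀ N : ℕ, 1 ≤ N → ∀ ξ : Fin N → ℕ, (∀ i, 1 ≤ ξ i) →
        Integrable (fun η => Real.exp (ρ * (rmax N η : ℝ))) ((K N).P T ξ) ∧
        (∫ η, Real.exp (ρ * (rmax N η : ℝ)) ∂ (K N).P T ξ)
            - Real.exp (ρ * (rmax N ξ : ℝ)) <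
          -c₁ * Real.exp (ρ * (rmax N ξ : ℝ))
              * (if A < (rmax N ξ : ℝ) then 1 else 0)
            + (N : ℝ) * c₂ * Real.exp (-C * (rmax N ξ : ℝ)) := by
  have hp0 := hp.nonneg 0
  obtain ⟨θ', hθ', hθσ', hφ'⟩ := hp.exists_phi_neg
  obtain ⟨θ, κ, hθ, hθθ', hκ, hφ⟩ :
      ∃ θ κ : ℝ, 0 < θ ∧ θ < θ' ∧ 0 < κ ∧ gwPhi p θ ≤ -κ :=
    ⟨θ' / 2, -(gwPhi p θ' / 2), by linarith, by linarith, by linarith, by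
      linarith [hp.phi_half_le hθ'.le hθσ']⟩
  set B : ℝ := 1 + (3 * p 0 + κ / 4) / (κ / 4) * Real.exp (θ * (3 * p 0 / κ))
  have hB : 0 < B := by positivity
  refine ⟨3 * θ / κ, 8 * Real.log 2 / θ, 1 / 2, B + 1, θ / 8, θ / 4, by positivity,
    by have := Real.log_pos one_lt_two; positivity, by norm_num, by positivity,
    by positivity, by positivity, fun N hN ξ hξ => ?_⟩
  have hR : 1 ≤ rmax N ξ :=
    (hξ ⟨0, hN⟩).trans (Finset.le_sup (f := ξ) (Finset.mem_univ _))
  obtain ⟨hint, hbd⟩ := integral_exp_rmax_le_quarter hp (hK N hN) hθ (by linarith) hκ hφ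
    hθθ' hθσ' hφ'.le hN ξ hR
  have hprob := (K N).prob (3 * θ / κ) ξ
  set R : ℝ := (rmax N ξ : ℝ)
  have hmaj : Integrable (fun η => Real.exp (θ / 4 * R / 2) +
      Real.exp (-(3 * θ / 8) * R) * Real.exp (θ * (rmax N η : ℝ)))
      ((K N).P (3 * θ / κ) ξ) := (integrable_const _).add (hint.const_mul _)
  have hint4 : Integrable (fun η => Real.exp (θ / 4 * (rmax N η : ℝ)))
      ((K N).P (3 * θ / κ) ξ) := by
    refine hmaj.mono' (Measurable.of_discrete).aestronglyMeasurable
      (Eventually.of_forall fun η => ?_)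
    rw [Real.norm_eq_abs, abs_of_pos (Real.exp_pos _)]
    exact exp_le_exp_half_add _ _ _ hθ
  refine ⟨hint4, ?_⟩
  have h1 := integral_mono hint4 hmaj fun η => exp_le_exp_half_add (rmax N η) R θ hθ
  rw [integral_add (integrable_const _) (hint.const_mul _), integral_const_mul,
    integral_const] at h1
  simp only [probReal_univ, one_smul] at h1
  have h2 := mul_le_mul_of_nonneg_left hbd (Real.exp_pos (-(3 * θ / 8) * R)).le
  have h3 : Real.exp (-(3 * θ / 8) * R) * (N * B * Real.exp (θ / 4 * R)) =
      N * B * Real.exp (-(θ / 8) * R) := by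
    rw [mul_left_comm, ← Real.exp_add]
    ring_nf
  rw [h3] at h2
  have h4 : 0 < (N : ℝ) * Real.exp (-(θ / 8) * R) := by
    have : (0 : ℝ) < N := by exact_mod_cast hN
    positivity
  have h5 : Real.exp (θ / 4 * R) = Real.exp (θ / 4 * R / 2) ^ 2 := by
    rw [← Real.exp_nat_mul]
    push_cast
    ring_nf
  have h6 : Real.exp (θ / 4 * R / 2) - Real.exp (θ / 4 * R) ≤
      -(1 / 2) * Real.exp (θ / 4 * R) * (if 8 * Real.log 2 / θ < R then 1 else 0) := by
    rw [h5]
    split_ifs with hA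
    · have h7 : 2 ≤ Real.exp (θ / 4 * R / 2) := by
        rw [div_lt_iff₀ hθ] at hA
        calc (2 : ℝ) = Real.exp (Real.log 2) := (Real.exp_log two_pos).symm
          _ ≤ _ := Real.exp_le_exp.2 (by linarith)
      nlinarith
    · have hR0 : 0 ≤ R := Nat.cast_nonneg _
      have h7 : 1 ≤ Real.exp (θ / 4 * R / 2) := Real.one_le_exp (by positivity)
      nlinarith
  have h8 : (N : ℝ) * (B + 1) * Real.exp (-(θ / 8) * R) =
      N * B * Real.exp (-(θ / 8) * R) + N * Real.exp (-(θ / 8) * R) := by ring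
  rw [h8]
  linarith

end
end

section
/- Let σ' > 0 satisfy E[exp(σ' H¹)] < ∞, where H^x is the total number of births of the Galton-Watson process started at x. Then for every f in the class F = {f : ℕ∪{0} → ℝ : ∑_{ℓ≥0} e^{−ρℓ}|f(ℓ)| < ∞ for some ρ < σ'}, the generator Qf(x) = ∑_{ℓ≥−1} x p(ℓ+1)(f(x+ℓ) − f(x)) is well defined, and the Kolmogorov equations hold: d/dt S_t f = Q S_t f = S_t Q f, where S_t f(x) = E[f(Z^x_t)] is the Galton-Watson semigroup. -/
open MeasureTheory Filter Topology Set

noncomputable section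

namespace OffspringLaw

variable {p : ℕ → ℝ} {σ v : ℝ}

lemma hasSum_one (hp : OffspringLaw p σ v) : HasSum p 1 := by
  have hs : Summable p := by
    by_contra h
    have := hp.total
    rw [tsum_eq_zero_of_not_summable h] at this
    exact zero_ne_one this
  exact hp.total ▸ hs.hasSum

lemma hasSum_drift (hp : OffspringLaw p σ v) :
    HasSum (fun k : ℕ => ((k : ℝ) - 1) * p k) (-v) := by
  have hs : Summable fun k : ℕ => ((k : ℝ) - 1) * p k := by
    by_contra h
    have h1 := hp.drift
    rw [tsum_eq_zero_of_not_summable h] at h1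
    have := hp.v_pos
    linarith
  exact hp.drift ▸ hs.hasSum

lemma hasSum_mul_cast_add (hp : OffspringLaw p σ v) {n : ℕ} (hn : 1 ≤ n) :
    HasSum (fun k => p k * ((n + k - 1 : ℕ) : ℝ)) (n - v) := by
  have h := hp.hasSum_drift.add (hp.hasSum_one.mul_right (n : ℝ))
  rw [one_mul, neg_add_eq_sub] at h
  refine h.congr_fun fun k => ?_
  rw [Nat.cast_sub (by omega)]
  push_cast
  ring

lemma summable_mul (hp : OffspringLaw p σ v) {g : ℕ → ℝ} {C : ℝ} (hg : ∀ k, |g k| ≤ C) :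
    Summable fun k => p k * g k := by
  refine (hp.hasSum_one.summable.mul_right C).of_norm_bounded fun k => ?_
  rw [Real.norm_eq_abs, abs_mul, abs_of_nonneg (hp.nonneg k)]
  exact mul_le_mul_of_nonneg_left (hg k) (hp.nonneg k)

lemma tsum_mul_le (hp : OffspringLaw p σ v) {g : ℕ → ℝ} {C : ℝ}
    (hs : Summable fun k => p k * g k) (hg : ∀ k, g k ≤ C) : ∑' k, p k * g k ≤ C := by
  have h := hp.hasSum_one.mul_right C
  rw [one_mul] at h
  exact hasSum_le (fun k => mul_le_mul_of_nonneg_left (hg k) (hp.nonneg k)) hs.hasSum h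

lemma abs_tsum_mul_le (hp : OffspringLaw p σ v) {g : ℕ → ℝ} {C : ℝ}
    (hg : ∀ k, |g k| ≤ C) : |∑' k, p k * g k| ≤ C := by
  have hs := hp.summable_mul hg
  refine abs_le.2 ⟨?_, hp.tsum_mul_le hs fun k => (abs_le.1 (hg k)).2⟩
  have h := hp.tsum_mul_le (g := fun k => -g k) (C := C)
    (by simpa using hs.neg) fun k => by linarith [(abs_le.1 (hg k)).1]
  simp only [mul_neg, tsum_neg] at h
  linarith

lemma gwbGen_eq (hp : OffspringLaw p σ v) {f : ℕ × ℕ → ℝ} {w : ℕ × ℕ}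
    (hs : Summable fun k => p k * f (w.1 + k - 1, w.2 + k)) :
    gwbGen p f w = w.1 * (∑' k, p k * f (w.1 + k - 1, w.2 + k) - f w) := by
  have h := (hs.hasSum.sub (hp.hasSum_one.mul_right (f w))).mul_left (w.1 : ℝ)
  rw [one_mul] at h
  rw [← h.tsum_eq, gwbGen]
  exact tsum_congr fun k => by ring

lemma abs_gwbGen_le (hp : OffspringLaw p σ v) {f : ℕ × ℕ → ℝ} {C : ℝ}
    (hf : ∀ w, |f w| ≤ C) (w : ℕ × ℕ) : |gwbGen p f w| ≤ w.1 * (2 * C) := by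
  rw [hp.gwbGen_eq (hp.summable_mul fun k => hf _), abs_mul, Nat.abs_cast]
  refine mul_le_mul_of_nonneg_left ?_ (Nat.cast_nonneg _)
  refine (abs_sub _ _).trans ?_
  linarith [hp.abs_tsum_mul_le (g := fun k => f (w.1 + k - 1, w.2 + k)) fun k => hf _, hf w]

end OffspringLaw

/-- Growth of a function on `[0, ∞)` from a lower bound on its derivative. -/
lemma add_mul_le_of_le_derivWithin {φ φ' : ℝ → ℝ} {c T : ℝ} (hT : 0 ≤ T)
    (h : ∀ t, 0 ≤ t → HasDerivWithinAt φ (φ' t) (Ici 0) t)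
    (hc : ∀ t, 0 ≤ t → t ≤ T → c ≤ φ' t) : φ 0 + c * T ≤ φ T := by
  have hd : ∀ t ∈ Icc 0 T,
      HasDerivWithinAt (fun t => φ t - c * t) (φ' t - c) (Ici 0) t := fun t ht => by
    simpa using (h t ht.1).fun_sub ((hasDerivWithinAt_id t _).const_mul c)
  have hm : MonotoneOn (fun t => φ t - c * t) (Icc 0 T) := by
    refine monotoneOn_of_hasDerivWithinAt_nonneg (f' := fun t => φ' t - c) (convex_Icc 0 T)
      (fun t ht => ((hd t ht).continuousWithinAt).mono Icc_subset_Ici_self)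
      (fun t ht => ((hd t (interior_subset ht)).mono
        (interior_subset.trans Icc_subset_Ici_self))) fun t ht => ?_
    have := interior_subset ht
    linarith [hc t this.1 this.2]
  have := hm ⟨le_rfl, hT⟩ ⟨hT, le_rfl⟩ hT
  simp only at this
  linarith

lemma Bounded.integrable {S : Type*} [MeasurableSpace S] [DiscreteMeasurableSpace S] [Countable S]
    {f : S → ℝ} (hf : Bounded f) (μ : Measure S) [IsFiniteMeasure μ] : Integrable f μ := by
  obtain ⟨C, hC⟩ := hf
  exact Integrable.of_bound (Measurable.of_discrete.aestronglyMeasurable) C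
    (Eventually.of_forall hC)

namespace IsGWBSemigroup

variable {p : ℕ → ℝ} {σ v : ℝ} {W : MarkovSemigroup (ℕ × ℕ)}

lemma integral_zero (W : MarkovSemigroup (ℕ × ℕ)) (f : ℕ × ℕ → ℝ) (w : ℕ × ℕ) :
    ∫ z, f z ∂W.P 0 w = f w := by
  rw [W.init, integral_dirac]

lemma integral_le (hW : IsGWBSemigroup p W) {f : ℕ × ℕ → ℝ} (hf : Bounded f)
    (hG : ∀ w, gwbGen p f w ≤ 0) (w : ℕ × ℕ) {t : ℝ} (ht : 0 ≤ t) :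
    ∫ z, f z ∂W.P t w ≤ f w := by
  have := add_mul_le_of_le_derivWithin (c := 0) ht (fun s hs => (hW f hf w s hs).neg)
    fun s hs _ => neg_nonneg.2 (integral_nonpos hG)
  simp only [integral_zero, Pi.neg_apply] at this
  linarith

/-- Nonnegative excessive functions have a supermartingale bound. -/
lemma integrable_and_integral_le (hp : OffspringLaw p σ v) (hW : IsGWBSemigroup p W)
    {V : ℕ × ℕ → ℝ} (hV0 : ∀ w, 0 ≤ V w)
    (hV : ∀ w : ℕ × ℕ, 1 ≤ w.1 → Summable (fun k => p k * V (w.1 + k - 1, w.2 + k)) ∧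
      ∑' k, p k * V (w.1 + k - 1, w.2 + k) ≤ V w) (w : ℕ × ℕ) {t : ℝ} (ht : 0 ≤ t) :
    Integrable V (W.P t w) ∧ ∫ z, V z ∂W.P t w ≤ V w := by
  have := W.prob t w
  have hb : ∀ n : ℕ, ∀ z, |min (V z) n| ≤ n := fun n z => by
    rw [abs_of_nonneg (le_min (hV0 z) n.cast_nonneg)]
    exact min_le_right _ _
  have hle : ∀ n : ℕ, ∫ z, min (V z) n ∂W.P t w ≤ V w := fun n => by
    refine (hW.integral_le ⟨n, hb n⟩ (fun z => ?_) w ht).trans (min_le_left _ _)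
    have hs := hp.summable_mul (g := fun k => min (V (z.1 + k - 1, z.2 + k)) n) fun k => hb n _
    rw [hp.gwbGen_eq (f := fun z => min (V z) n) hs]
    rcases Nat.eq_zero_or_pos z.1 with h0 | h1
    · simp [h0]
    refine mul_nonpos_of_nonneg_of_nonpos z.1.cast_nonneg (sub_nonpos.2 (le_min ?_ ?_))
    · refine (hs.tsum_le_tsum (fun k => ?_) (hV z h1).1).trans (hV z h1).2
      exact mul_le_mul_of_nonneg_left (min_le_left _ _) (hp.nonneg k)
    · exact hp.tsum_mul_le hs fun k => min_le_right _ _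
  have hlim : ∀ z, Tendsto (fun n : ℕ => ENNReal.ofReal (min (V z) n)) atTop
      (𝓝 (ENNReal.ofReal (V z))) := fun z => by
    refine tendsto_const_nhds.congr' ?_
    filter_upwards [eventually_ge_atTop ⌈V z⌉₊] with n hn
    rw [min_eq_left (Nat.ceil_le.1 hn)]
  have hlin : ∫⁻ z, ENNReal.ofReal (V z) ∂W.P t w ≤ ENNReal.ofReal (V w) := by
    calc ∫⁻ z, ENNReal.ofReal (V z) ∂W.P t w
        = ∫⁻ z, liminf (fun n : ℕ => ENNReal.ofReal (min (V z) n)) atTop ∂W.P t w :=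
          lintegral_congr fun z => (hlim z).liminf_eq.symm
      _ ≤ liminf (fun n : ℕ => ∫⁻ z, ENNReal.ofReal (min (V z) n) ∂W.P t w) atTop :=
          lintegral_liminf_le fun n => Measurable.of_discrete
      _ ≤ ENNReal.ofReal (V w) := by
          refine liminf_le_of_le (by isBoundedDefault) fun b hb' => ?_
          obtain ⟨n, hn⟩ := hb'.exists
          refine hn.trans ?_
          rw [← ofReal_integral_eq_lintegral_ofReal (Bounded.integrable ⟨n, hb n⟩ _)
            (Eventually.of_forall fun z => le_min (hV0 z) n.cast_nonneg)]
          exact ENNReal.ofReal_le_ofReal (hle n)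
  have hm : AEStronglyMeasurable V (W.P t w) := Measurable.of_discrete.aestronglyMeasurable
  have hi : Integrable V (W.P t w) := by
    refine ⟨hm, ?_⟩
    rw [hasFiniteIntegral_iff_ofReal (Eventually.of_forall hV0)]
    exact hlin.trans_lt ENNReal.ofReal_lt_top
  refine ⟨hi, ?_⟩
  rw [← ofReal_integral_eq_lintegral_ofReal hi (Eventually.of_forall hV0)] at hlin
  exact (ENNReal.ofReal_le_ofReal_iff (hV0 w)).1 hlin

lemma integrable_fst (hp : OffspringLaw p σ v) (hW : IsGWBSemigroup p W) (w : ℕ × ℕ) {t : ℝ}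
    (ht : 0 ≤ t) : Integrable (fun z => (z.1 : ℝ)) (W.P t w) := by
  refine (integrable_and_integral_le hp hW (V := fun z => (z.1 : ℝ))
    (fun z => Nat.cast_nonneg _) (fun z hz => ?_) w ht).1
  have h := hp.hasSum_mul_cast_add hz
  exact ⟨h.summable, h.tsum_eq.le.trans (sub_le_self _ hp.v_pos.le)⟩

lemma integrable_gwbGen (hp : OffspringLaw p σ v) (hW : IsGWBSemigroup p W) {f : ℕ × ℕ → ℝ}
    (hf : Bounded f) (w : ℕ × ℕ) {t : ℝ} (ht : 0 ≤ t) :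
    Integrable (gwbGen p f) (W.P t w) := by
  obtain ⟨C, hC⟩ := hf
  exact ((integrable_fst hp hW w ht).mul_const (2 * C)).mono'
    Measurable.of_discrete.aestronglyMeasurable
    (Eventually.of_forall fun z => hp.abs_gwbGen_le hC z)

lemma bounded_integral (W : MarkovSemigroup (ℕ × ℕ)) {f : ℕ × ℕ → ℝ} {C : ℝ}
    (hC : ∀ w, |f w| ≤ C) (t : ℝ) (w : ℕ × ℕ) : |∫ z, f z ∂W.P t w| ≤ C := by
  have := W.prob t w
  simpa using norm_integral_le_of_norm_le_const (f := f) (μ := W.P t w) (Eventually.of_forall hC)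

/-- Kolmogorov's backward equation for bounded observables. -/
lemma gwbGen_integral (hW : IsGWBSemigroup p W) {f : ℕ × ℕ → ℝ} (hf : Bounded f) (w : ℕ × ℕ)
    {t : ℝ} (ht : 0 ≤ t) :
    gwbGen p (fun z => ∫ y, f y ∂W.P t z) w = ∫ z, gwbGen p f z ∂W.P t w := by
  obtain ⟨C, hC⟩ := id hf
  have h1 := hW (fun z => ∫ y, f y ∂W.P t z) ⟨C, bounded_integral W hC t⟩ w 0 le_rfl
  rw [integral_zero] at h1
  have h2 : HasDerivWithinAt (fun s => ∫ y, f y ∂W.P (s + t) w)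
      (∫ z, gwbGen p f z ∂W.P t w) (Ici 0) 0 := by
    have h3 : HasDerivWithinAt (fun u => ∫ y, f y ∂W.P u w)
      (∫ z, gwbGen p f z ∂W.P t w) (Ici 0) (0 + t) := by
      rw [zero_add]; exact hW f hf w t ht
    have h4 : HasDerivWithinAt (fun s : ℝ => s + t) 1 (Ici 0) 0 :=
      (hasDerivWithinAt_id _ _).add_const t
    simpa [Function.comp_def] using
      h3.comp (0 : ℝ) h4 fun s (hs : 0 ≤ s) => add_nonneg hs ht
  refine (uniqueDiffWithinAt_Ici (0 : ℝ)).eq_deriv _ h1 (h2.congr_of_mem (fun s hs => ?_) ?_)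
  · have := W.prob (s + t) w
    let κ : ProbabilityTheory.Kernel (ℕ × ℕ) (ℕ × ℕ) := ⟨W.P s, W.meas s⟩
    let η : ProbabilityTheory.Kernel (ℕ × ℕ) (ℕ × ℕ) := ⟨W.P t, W.meas t⟩
    have he : (ProbabilityTheory.Kernel.comp η κ) w = W.P (s + t) w := by
      rw [ProbabilityTheory.Kernel.comp_apply, W.semigroup s t hs ht]
      rfl
    have hi : Integrable f ((ProbabilityTheory.Kernel.comp η κ) w) := by
      rw [he]; exact hf.integrable _
    have := ProbabilityTheory.Kernel.integral_comp hi
    rw [he] at this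
    exact this.symm
  · exact le_refl (0 : ℝ)

end IsGWBSemigroup

/-- A solution of a linear relaxation equation stays below a bound on its target. -/
lemma le_of_hasDerivWithinAt_relax {y m : ℝ → ℝ} {x A : ℝ} (hx : 0 ≤ x) (hA : 0 ≤ A)
    (h0 : y 0 = 0) (hm : ∀ t, 0 ≤ t → m t ≤ A)
    (h : ∀ t, 0 ≤ t → HasDerivWithinAt y (x * (m t - y t)) (Ici 0) t) {t : ℝ} (ht : 0 ≤ t) :
    y t ≤ A := by
  have hd : ∀ s, 0 ≤ s → HasDerivWithinAt (fun s => Real.exp (x * s) * (A - y s))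
      (Real.exp (x * s) * (x * (A - m s))) (Ici 0) s := fun s hs => by
    have h1 : HasDerivWithinAt (fun s => Real.exp (x * s)) (Real.exp (x * s) * x) (Ici 0) s := by
      simpa using (((hasDerivAt_id s).const_mul x).exp).hasDerivWithinAt
    refine (h1.fun_mul ((h s hs).const_sub A)).congr_deriv ?_
    ring
  have := add_mul_le_of_le_derivWithin (c := 0) ht hd fun s hs _ =>
    mul_nonneg (Real.exp_pos _).le (mul_nonneg hx (sub_nonneg.2 (hm s hs)))
  simp only [mul_zero, Real.exp_zero, h0, sub_zero, one_mul, zero_mul, add_zero] at this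
  by_contra hlt
  nlinarith [mul_pos (Real.exp_pos (x * t)) (sub_pos.2 (not_le.1 hlt))]

namespace IsGWBSemigroup

variable {p : ℕ → ℝ} {σ v : ℝ} {W : MarkovSemigroup (ℕ × ℕ)}

/-- A bounded solution of the backward equation started from zero vanishes. -/
lemma eq_zero_of_backward (hp : OffspringLaw p σ v) {d : ℝ → ℕ × ℕ → ℝ} {D : ℝ}
    (hD : ∀ t, 0 ≤ t → ∀ w, |d t w| ≤ D) (h0 : ∀ w, d 0 w = 0)
    (h : ∀ t, 0 ≤ t → ∀ w, HasDerivWithinAt (fun s => d s w)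
      (w.1 * (∑' k, p k * d t (w.1 + k - 1, w.2 + k) - d t w)) (Ici 0) t)
    {t : ℝ} (ht : 0 ≤ t) (w : ℕ × ℕ) : d t w = 0 := by
  have hD0 : 0 ≤ D := (abs_nonneg _).trans (hD 0 le_rfl (0, 0))
  have step : ∀ (x A : ℝ) (w : ℕ × ℕ), x = w.1 → 0 ≤ A →
      (∀ s, 0 ≤ s → |∑' k, p k * d s (w.1 + k - 1, w.2 + k)| ≤ A) →
      ∀ s, 0 ≤ s → |d s w| ≤ A := by
    rintro x A w rfl hA hm s hs
    refine abs_le'.2 ⟨?_, ?_⟩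
    · exact le_of_hasDerivWithinAt_relax (y := fun s => d s w) w.1.cast_nonneg hA (h0 w)
        (fun s hs => (abs_le'.1 (hm s hs)).1) (fun s hs => h s hs w) hs
    · refine le_of_hasDerivWithinAt_relax (y := fun s => -d s w) w.1.cast_nonneg hA
        (by simp [h0]) (fun s hs => (abs_le'.1 (hm s hs)).2) (fun s hs => ?_) hs
      refine (h s hs w).fun_neg.congr_deriv ?_
      ring
  have hzero : ∀ s, 0 ≤ s → ∀ w : ℕ × ℕ, w.1 = 0 → d s w = 0 := fun s hs w hw => by
    have hc := add_mul_le_of_le_derivWithin (c := 0) hs (fun s hs => h s hs w)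
      fun s _ _ => by simp [hw]
    have hc' := add_mul_le_of_le_derivWithin (c := 0) hs (fun s hs => (h s hs w).fun_neg)
      fun s _ _ => by simp [hw]
    simp only [h0] at hc hc'
    linarith
  let S : Set ℝ := {N | 0 ≤ N ∧ ∀ s, 0 ≤ s → ∀ w : ℕ × ℕ, |d s w| ≤ N * (1 + w.1)}
  have hDS : D ∈ S := ⟨hD0, fun s hs w => (hD s hs w).trans
    (le_mul_of_one_le_right hD0 (by linarith [w.1.cast_nonneg (α := ℝ)]))⟩
  have hSb : BddBelow S := ⟨0, fun N hN => hN.1⟩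
  set N := sInf S
  have hN0 : 0 ≤ N := le_csInf ⟨D, hDS⟩ fun N hN => hN.1
  have hNle : ∀ s, 0 ≤ s → ∀ w : ℕ × ℕ, |d s w| ≤ N * (1 + w.1) := fun s hs w => by
    have hw : (0 : ℝ) < 1 + w.1 := by positivity
    rw [← div_le_iff₀ hw]
    exact le_csInf ⟨D, hDS⟩ fun N' hN' => (div_le_iff₀ hw).2 (hN'.2 s hs w)
  have hNz : N = 0 := by
    by_contra hne
    have hNpos : 0 < N := lt_of_le_of_ne hN0 (Ne.symm hne)
    have hv := hp.v_pos
    set K := D / (N / 2) with hK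
    have hK0 : 0 ≤ K := by positivity
    have hKD : N / 2 * K = D := by rw [hK]; field_simp
    set q := max (1 / 2 : ℝ) (1 - v / (1 + K))
    have hq1 : q < 1 := max_lt (by norm_num) (by linarith [div_pos hv (by linarith : 0 < 1 + K)])
    have hqh : 1 / 2 ≤ q := le_max_left _ _
    have hmem : N * q ∈ S := by
      refine ⟨by positivity, fun s hs w => ?_⟩
      have hw0 : (0 : ℝ) ≤ w.1 := w.1.cast_nonneg
      rcases Nat.eq_zero_or_pos w.1 with hz | hz
      · rw [hzero s hs w hz, abs_zero]
        positivity
      rcases le_or_gt K w.1 with hKw | hKw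
      · refine (hD s hs w).trans ?_
        rw [← hKD]
        have : N / 2 * K ≤ N / 2 * (1 + w.1) :=
          mul_le_mul_of_nonneg_left (by linarith) (by linarith)
        have h2 : N * (1 / 2) * (1 + w.1) ≤ N * q * (1 + w.1) := by gcongr
        linarith
      · have hsum : HasSum (fun k : ℕ => p k * (N * (1 + ((w.1 + k - 1 : ℕ) : ℝ))))
            (N * (1 + w.1 - v)) := by
          have h1 := (hp.hasSum_one.add (hp.hasSum_mul_cast_add hz)).mul_left N
          rw [← add_sub_assoc] at h1
          exact h1.congr_fun fun k => by ring
        have hA : ∀ r, 0 ≤ r → |∑' k, p k * d r (w.1 + k - 1, w.2 + k)| ≤ N * (1 + w.1 - v) :=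
          fun r hr => by
            rw [← Real.norm_eq_abs]
            refine tsum_of_norm_bounded hsum fun k => ?_
            rw [Real.norm_eq_abs, abs_mul, abs_of_nonneg (hp.nonneg k)]
            exact mul_le_mul_of_nonneg_left (hNle r hr _) (hp.nonneg k)
        refine (step _ _ w rfl ((abs_nonneg _).trans (hA 0 le_rfl)) hA s hs).trans ?_
        rw [mul_assoc]
        refine mul_le_mul_of_nonneg_left ?_ hN0
        have h3 : (1 - v / (1 + K)) * (1 + w.1) ≤ q * (1 + w.1) :=
          mul_le_mul_of_nonneg_right (le_max_right _ _) (by linarith)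
        have h4 : v / (1 + K) * (1 + w.1) ≤ v := by
          rw [div_mul_eq_mul_div, div_le_iff₀ (by linarith)]
          exact mul_le_mul_of_nonneg_left (by linarith) hv.le
        linarith
    have := csInf_le hSb hmem
    nlinarith
  have := hNle t ht w
  rw [hNz, zero_mul] at this
  exact abs_nonpos_iff.1 this

/-- The law of the population size does not depend on the initial birth count. -/
lemma integral_fst_eq (hp : OffspringLaw p σ v) (hW : IsGWBSemigroup p W) {f : ℕ → ℝ}
    (hf : Bounded f) {t : ℝ} (ht : 0 ≤ t) (x b : ℕ) :
    ∫ z, f z.1 ∂W.P t (x, b) = ∫ z, f z.1 ∂W.P t (x, 0) := by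
  obtain ⟨C, hC⟩ := hf
  have hfb : Bounded fun z : ℕ × ℕ => f z.1 := ⟨C, fun z => hC z.1⟩
  induction b with
  | zero => rfl
  | succ b ih =>
    rw [← ih]
    let u : ℝ → ℕ × ℕ → ℝ := fun t w => ∫ z, f z.1 ∂W.P t w
    have hb : ∀ t w, |u t w| ≤ C := bounded_integral W (f := fun z : ℕ × ℕ => f z.1) fun z => hC z.1
    have hu : ∀ t, 0 ≤ t → ∀ w : ℕ × ℕ, HasDerivWithinAt (fun s => u s w)
        (w.1 * (∑' k, p k * u t (w.1 + k - 1, w.2 + k) - u t w)) (Ici 0) t := fun t ht w => by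
      rw [← hp.gwbGen_eq (f := u t) (hp.summable_mul fun k => hb t (w.1 + k - 1, w.2 + k)),
        hW.gwbGen_integral hfb _ ht]
      exact hW _ hfb w t ht
    refine sub_eq_zero.1 (eq_zero_of_backward hp (D := 2 * C) (d := fun t w =>
      u t (w.1, w.2 + 1) - u t w) (fun t _ w => (abs_sub _ _).trans
        (by linarith [hb t w, hb t (w.1, w.2 + 1)]))
      (fun w => by simp only [u, integral_zero, sub_self]) (fun t ht w => ?_) ht (x, b))
    refine ((hu t ht (w.1, w.2 + 1)).fun_sub (hu t ht w)).congr_deriv ?_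
    have h3 := (hp.summable_mul fun k => hb t (w.1 + k - 1, w.2 + 1 + k)).tsum_sub
      (hp.summable_mul fun k => hb t (w.1 + k - 1, w.2 + k))
    simp only [← mul_sub, add_right_comm w.2 1] at h3 ⊢
    rw [h3]
    ring

/-- Started from one individual, the population never exceeds one plus the number of births. -/
lemma ae_fst_le (hW : IsGWBSemigroup p W) (hp0 : ∀ k, 0 ≤ p k) {t : ℝ} (ht : 0 ≤ t) :
    ∀ᵐ z ∂W.P t (1, 0), z.1 ≤ 1 + z.2 := by
  have := W.prob t (1, 0)
  let f : ℕ × ℕ → ℝ := fun z => if z.1 ≤ 1 + z.2 then 0 else 1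
  have hf0 : ∀ z, 0 ≤ f z := fun z => by dsimp only [f]; split_ifs <;> norm_num
  have hf1 : ∀ z, f z ≤ 1 := fun z => by dsimp only [f]; split_ifs <;> norm_num
  have hfb : Bounded f := ⟨1, fun z => by rw [abs_of_nonneg (hf0 z)]; exact hf1 z⟩
  have hG : ∀ w, gwbGen p f w ≤ 0 := fun w => tsum_nonpos fun k => by
    rcases Nat.eq_zero_or_pos w.1 with hz | hz
    · simp [hz]
    refine mul_nonpos_of_nonneg_of_nonpos (mul_nonneg w.1.cast_nonneg (hp0 k)) (sub_nonpos.2 ?_)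
    by_cases hw : w.1 ≤ 1 + w.2
    · have : f (w.1 + k - 1, w.2 + k) = 0 := if_pos (by simp only; omega)
      rw [this]
      exact hf0 w
    · rw [show f w = 1 from if_neg hw]
      exact hf1 _
  have hle := hW.integral_le hfb hG (1, 0) ht
  have hz : ∫ z, f z ∂W.P t (1, 0) = 0 :=
    le_antisymm (hle.trans_eq (if_pos (by norm_num))) (integral_nonneg hf0)
  filter_upwards [(integral_eq_zero_iff_of_nonneg hf0 (hfb.integrable _)).1 hz] with z hz'
  by_contra hcon
  have : f z = 1 := if_neg hcon
  rw [this] at hz'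
  simp at hz'

/-- Finite exponential moments of the births pass to the offspring law. -/
lemma summable_offspring_pow (hp : OffspringLaw p σ v) (hW : IsGWBSemigroup p W) {a M : ℝ}
    (ha : 1 ≤ a) (hM : ∀ t, 0 ≤ t → Integrable (fun z => a ^ (1 + z.2)) (W.P t (1, 0)) ∧
      ∫ z, a ^ (1 + z.2) ∂W.P t (1, 0) ≤ M) :
    Summable fun k => p k * a ^ k := by
  let w₀ : ℕ × ℕ := (1, 0)
  let e : ℕ × ℕ → ℝ := fun z => if z = w₀ then 1 else 0
  have heb : Bounded e := ⟨1, fun z => by dsimp only [e]; split_ifs <;> norm_num⟩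
  obtain ⟨δ, hδ, hδe⟩ : ∃ δ > 0, ∀ t, 0 ≤ t → t ≤ δ → 1 / 2 ≤ ∫ z, e z ∂W.P t w₀ := by
    have hc := (hW e heb w₀ 0 le_rfl).continuousWithinAt.eventually
      (lt_mem_nhds (a := (1 / 2 : ℝ)) (by simp only [integral_zero]; simp [e]; norm_num))
    obtain ⟨δ, hδ, hsub⟩ := Metric.mem_nhdsWithin_iff.1 hc
    refine ⟨δ / 2, by positivity, fun t ht0 ht => le_of_lt (hsub ⟨?_, ht0⟩)⟩
    rw [Metric.mem_ball, Real.dist_eq, sub_zero, abs_of_nonneg ht0]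
    linarith
  have key : ∀ n : ℕ, ∑ k ∈ Finset.range n, p k * a ^ k ≤ 2 * M / δ + a := fun n => by
    let f : ℕ × ℕ → ℝ := fun z => min (a ^ (1 + z.2)) (a ^ (1 + n))
    have hf0 : ∀ z, 0 ≤ f z := fun z => le_min (by positivity) (by positivity)
    have hfa : ∀ z, |f z| ≤ a ^ (1 + n) := fun z => by
      rw [abs_of_nonneg (hf0 z)]; exact min_le_right _ _
    have hfb : Bounded f := ⟨_, hfa⟩
    have hG : ∀ w, 0 ≤ gwbGen p f w := fun w => tsum_nonneg fun k =>
      mul_nonneg (mul_nonneg w.1.cast_nonneg (hp.nonneg k)) (sub_nonneg.2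
        (min_le_min_right _ (pow_le_pow_right₀ ha (by simp only; omega))))
    have hge : ∀ w, gwbGen p f w₀ * e w ≤ gwbGen p f w := fun w => by
      by_cases hw : w = w₀
      · simp [e, hw]
      · simpa [e, hw] using hG w
    have hfw : f w₀ = a := by
      simp only [f, w₀, add_zero, pow_one]
      exact min_eq_left (le_self_pow₀ ha (by omega))
    have hgrow := add_mul_le_of_le_derivWithin (c := gwbGen p f w₀ * (1 / 2)) hδ.le
      (fun s hs => hW f hfb w₀ s hs) fun s hs hsδ => by
        have := W.prob s w₀
        calc gwbGen p f w₀ * (1 / 2) ≤ gwbGen p f w₀ * ∫ z, e z ∂W.P s w₀ :=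
              mul_le_mul_of_nonneg_left (hδe s hs hsδ) (hG _)
          _ = ∫ z, gwbGen p f w₀ * e z ∂W.P s w₀ := (integral_const_mul _ _).symm
          _ ≤ ∫ z, gwbGen p f z ∂W.P s w₀ := integral_mono ((heb.integrable _).const_mul _)
              (integrable_gwbGen hp hW hfb w₀ hs) hge
    have := W.prob δ w₀
    have hup : ∫ z, f z ∂W.P δ w₀ ≤ M := (integral_mono (hfb.integrable _) (hM δ hδ.le).1
      fun z => min_le_left _ _).trans (hM δ hδ.le).2
    have hs := hp.summable_mul fun k => hfa (w₀.1 + k - 1, w₀.2 + k)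
    rw [integral_zero, hp.gwbGen_eq hs, hfw] at hgrow
    have hpart : ∑ k ∈ Finset.range n, p k * a ^ k ≤
        ∑' k, p k * f (w₀.1 + k - 1, w₀.2 + k) := by
      refine le_trans (Finset.sum_le_sum fun k hk => ?_) (hs.sum_le_tsum (Finset.range n)
        fun k _ => mul_nonneg (hp.nonneg k) (hf0 _))
      refine mul_le_mul_of_nonneg_left (le_min ?_ ?_) (hp.nonneg k)
      · exact pow_le_pow_right₀ ha (by simp only [w₀]; omega)
      · exact pow_le_pow_right₀ ha (by have := Finset.mem_range.1 hk; omega)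
    refine hpart.trans ?_
    rw [← sub_le_iff_le_add, le_div_iff₀ hδ]
    simp only [w₀, Nat.cast_one, one_mul] at hgrow ⊢
    linarith
  exact summable_of_sum_range_le (fun k => mul_nonneg (hp.nonneg k) (by positivity)) key

end IsGWBSemigroup

lemma exists_cast_mul_pow_le {b c : ℝ} (hb : 0 < b) (hbc : b < c) :
    ∃ K, 0 ≤ K ∧ ∀ n : ℕ, n * b ^ n ≤ K * c ^ n := by
  have hc : 0 < c := hb.trans hbc
  obtain ⟨K, hK⟩ := (tendsto_self_mul_const_pow_of_lt_one (r := b / c) (by positivity)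
    ((div_lt_one hc).2 hbc)).bddAbove_range
  have hK' : ∀ n : ℕ, n * b ^ n ≤ K * c ^ n := fun n => by
    have := hK ⟨n, rfl⟩
    simp only [div_pow] at this
    rwa [← mul_div_assoc, div_le_iff₀ (by positivity)] at this
  exact ⟨K, by simpa using hK' 0, hK'⟩

namespace OffspringLaw

variable {p : ℕ → ℝ} {σ v b C : ℝ} {f : ℕ → ℝ}

lemma abs_mul_shift_le (hp : OffspringLaw p σ v) (hb : 1 ≤ b) (hf : ∀ z, |f z| ≤ C * b ^ z)
    (x k : ℕ) : |p k * f (x + k - 1)| ≤ C * b ^ x * (p k * b ^ k) := by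
  have hC : 0 ≤ C := by simpa using (abs_nonneg _).trans (hf 0)
  rw [abs_mul, abs_of_nonneg (hp.nonneg k)]
  calc p k * |f (x + k - 1)| ≤ p k * (C * b ^ (x + k)) :=
        mul_le_mul_of_nonneg_left ((hf _).trans (mul_le_mul_of_nonneg_left
          (pow_le_pow_right₀ hb (Nat.sub_le _ _)) hC)) (hp.nonneg k)
    _ = C * b ^ x * (p k * b ^ k) := by rw [pow_add]; ring

lemma summable_mul_shift (hp : OffspringLaw p σ v) (hb : 1 ≤ b)
    (hs : Summable fun k => p k * b ^ k) (hf : ∀ z, |f z| ≤ C * b ^ z) (x : ℕ) :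
    Summable fun k => p k * f (x + k - 1) :=
  (hs.mul_left _).of_norm_bounded fun k => hp.abs_mul_shift_le hb hf x k

lemma gwQ_eq (hp : OffspringLaw p σ v) (hb : 1 ≤ b)
    (hs : Summable fun k => p k * b ^ k) (hf : ∀ z, |f z| ≤ C * b ^ z) (x : ℕ) :
    gwQ p f x = x * (∑' k, p k * f (x + k - 1) - f x) :=
  hp.gwbGen_eq (f := fun z => f z.1) (w := (x, 0)) (hp.summable_mul_shift hb hs hf x)

/-- The generator preserves exponential growth, up to an arbitrarily small loss in the rate. -/
lemma exists_abs_gwQ_le (hp : OffspringLaw p σ v) (hb : 1 ≤ b)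
    (hs : Summable fun k => p k * b ^ k) {c : ℝ} (hbc : b < c) (C : ℝ) :
    ∃ C', ∀ f : ℕ → ℝ, (∀ z, |f z| ≤ C * b ^ z) → ∀ z, |gwQ p f z| ≤ C' * c ^ z := by
  obtain ⟨K, hK0, hK⟩ := exists_cast_mul_pow_le (by linarith : 0 < b) hbc
  set G := ∑' k, p k * b ^ k
  have hG : 0 ≤ G := tsum_nonneg fun k => mul_nonneg (hp.nonneg k) (by positivity)
  refine ⟨C * (G + 1) * K, fun f hf z => ?_⟩
  have hC : 0 ≤ C := by simpa using (abs_nonneg _).trans (hf 0)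
  rw [hp.gwQ_eq hb hs hf, abs_mul, Nat.abs_cast]
  have h1 : |∑' k, p k * f (z + k - 1)| ≤ C * b ^ z * G := by
    rw [← Real.norm_eq_abs]
    exact tsum_of_norm_bounded (hs.hasSum.mul_left _) fun k => hp.abs_mul_shift_le hb hf z k
  calc (z : ℝ) * |∑' k, p k * f (z + k - 1) - f z|
      ≤ z * (C * b ^ z * G + C * b ^ z) := mul_le_mul_of_nonneg_left
        ((abs_sub _ _).trans (add_le_add h1 (hf z))) z.cast_nonneg
    _ = C * (G + 1) * (z * b ^ z) := by ring
    _ ≤ C * (G + 1) * (K * c ^ z) := mul_le_mul_of_nonneg_left (hK z) (by positivity)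
    _ = C * (G + 1) * K * c ^ z := by ring

lemma tendsto_gwQ (hp : OffspringLaw p σ v) (hb : 1 ≤ b)
    (hs : Summable fun k => p k * b ^ k) {F : ℕ → ℕ → ℝ}
    (hF : ∀ n z, |F n z| ≤ C * b ^ z) (hf : ∀ z, |f z| ≤ C * b ^ z)
    (hlim : ∀ z, Tendsto (fun n => F n z) atTop (𝓝 (f z))) (x : ℕ) :
    Tendsto (fun n => gwQ p (F n) x) atTop (𝓝 (gwQ p f x)) := by
  simp only [hp.gwQ_eq hb hs (hF _), hp.gwQ_eq hb hs hf]
  refine (Tendsto.sub ?_ (hlim x)).const_mul _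
  exact tendsto_tsum_of_dominated_convergence (hs.mul_left (C * b ^ x))
    (fun k => (hlim _).const_mul _)
    (Eventually.of_forall fun n k => hp.abs_mul_shift_le hb (hF n) x k)

end OffspringLaw

/-- Truncation of an observable above level `n`. -/
def truncObs (f : ℕ → ℝ) (n z : ℕ) : ℝ := if z ≤ n then f z else 0

lemma abs_truncObs_le (f : ℕ → ℝ) (n z : ℕ) : |truncObs f n z| ≤ |f z| := by
  unfold truncObs
  split_ifs <;> simp

lemma bounded_truncObs (f : ℕ → ℝ) (n : ℕ) : Bounded (truncObs f n) := by
  refine ⟨∑ k ∈ Finset.range (n + 1), |f k|, fun z => ?_⟩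
  unfold truncObs
  split_ifs with h
  · exact Finset.single_le_sum (f := fun k => |f k|) (fun k _ => abs_nonneg _)
      (Finset.mem_range.2 (by omega))
  · rw [abs_zero]
    exact Finset.sum_nonneg fun k _ => abs_nonneg _

lemma tendsto_truncObs (f : ℕ → ℝ) (z : ℕ) :
    Tendsto (fun n => truncObs f n z) atTop (𝓝 (f z)) := by
  refine tendsto_const_nhds.congr' ?_
  filter_upwards [eventually_ge_atTop z] with n hn
  exact (if_pos hn).symm

lemma Bounded.comp_fst {f : ℕ → ℝ} (hf : Bounded f) : Bounded fun z : ℕ × ℕ => f z.1 := by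
  obtain ⟨C, hC⟩ := hf
  exact ⟨C, fun z => hC z.1⟩

namespace IsGWBSemigroup

variable {p : ℕ → ℝ} {σ v : ℝ} {W : MarkovSemigroup (ℕ × ℕ)}

section Growth

variable {μ : Measure (ℕ × ℕ)} {a C : ℝ} {f : ℕ → ℝ}

lemma integrable_of_growth (hμ : Integrable (fun z => a ^ z.1) μ) (hf : ∀ z, |f z| ≤ C * a ^ z) :
    Integrable (fun z => f z.1) μ :=
  (hμ.const_mul C).mono' Measurable.of_discrete.aestronglyMeasurable
    (Eventually.of_forall fun z => hf z.1)

lemma abs_integral_le_of_growth (hμ : Integrable (fun z => a ^ z.1) μ)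
    (hf : ∀ z, |f z| ≤ C * a ^ z) : |∫ z, f z.1 ∂μ| ≤ C * ∫ z, a ^ z.1 ∂μ := by
  rw [← integral_const_mul, ← Real.norm_eq_abs]
  exact norm_integral_le_of_norm_le (hμ.const_mul C) (Eventually.of_forall fun z => hf z.1)

lemma tendsto_integral_of_growth (hμ : Integrable (fun z => a ^ z.1) μ) {F : ℕ → ℕ → ℝ}
    (hF : ∀ n z, |F n z| ≤ C * a ^ z) (hlim : ∀ z, Tendsto (fun n => F n z) atTop (𝓝 (f z))) :
    Tendsto (fun n => ∫ z, F n z.1 ∂μ) atTop (𝓝 (∫ z, f z.1 ∂μ)) :=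
  tendsto_integral_of_dominated_convergence (fun z => C * a ^ z.1)
    (fun _ => Measurable.of_discrete.aestronglyMeasurable) (hμ.const_mul C)
    (fun n => Eventually.of_forall fun z => hF n z.1) (Eventually.of_forall fun z => hlim z.1)

end Growth

lemma growth_mono {a b C : ℝ} {f : ℕ → ℝ} (hb : 0 ≤ b) (hab : b ≤ a)
    (hf : ∀ z, |f z| ≤ C * b ^ z) (z : ℕ) : |f z| ≤ C * a ^ z := by
  have hC : 0 ≤ C := by simpa using (abs_nonneg _).trans (hf 0)
  exact (hf z).trans (mul_le_mul_of_nonneg_left (pow_le_pow_left₀ hb hab z) hC)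

lemma continuousOn_integral_of_growth (hW : IsGWBSemigroup p W) {w : ℕ × ℕ} {a b C M : ℝ}
    {f : ℕ → ℝ} (hb : 0 < b) (hba : b < a)
    (hM : ∀ t, 0 ≤ t → Integrable (fun z => a ^ z.1) (W.P t w) ∧ ∫ z, a ^ z.1 ∂W.P t w ≤ M)
    (hf : ∀ z, |f z| ≤ C * b ^ z) : ContinuousOn (fun t => ∫ z, f z.1 ∂W.P t w) (Ici 0) := by
  have ha : 0 < a := hb.trans hba
  have hC : 0 ≤ C := by simpa using (abs_nonneg _).trans (hf 0)
  have hdiff : ∀ n z, |f z - truncObs f n z| ≤ C * (b / a) ^ n * a ^ z := fun n z => by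
    unfold truncObs
    split_ifs with h
    · rw [sub_self, abs_zero]
      positivity
    · rw [sub_zero]
      refine (hf z).trans ?_
      have h1 : b ^ z = (b / a) ^ z * a ^ z := by
        rw [← mul_pow, div_mul_cancel₀ _ ha.ne']
      rw [h1, ← mul_assoc]
      refine mul_le_mul_of_nonneg_right (mul_le_mul_of_nonneg_left ?_ hC) (by positivity)
      exact pow_le_pow_of_le_one (by positivity) ((div_le_one ha).2 hba.le) (by omega)
  have hu : TendstoUniformlyOn (fun n t => ∫ z, truncObs f n z.1 ∂W.P t w)
      (fun t => ∫ z, f z.1 ∂W.P t w) atTop (Ici 0) := by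
    rw [Metric.tendstoUniformlyOn_iff]
    intro ε hε
    have hlim : Tendsto (fun n : ℕ => C * (b / a) ^ n * M) atTop (𝓝 0) := by
      have := ((tendsto_pow_atTop_nhds_zero_of_lt_one (r := b / a) (by positivity)
        ((div_lt_one ha).2 hba)).const_mul C).mul_const M
      simpa using this
    filter_upwards [hlim.eventually (gt_mem_nhds hε)] with n hn t ht
    have := W.prob t w
    refine lt_of_le_of_lt ?_ hn
    rw [Real.dist_eq, ← integral_sub
      (integrable_of_growth (hM t ht).1 (growth_mono hb.le hba.le hf))
      ((bounded_truncObs f n).comp_fst.integrable _)]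
    refine (abs_integral_le_of_growth (f := fun z => f z - truncObs f n z)
      (hM t ht).1 (hdiff n)).trans ?_
    exact mul_le_mul_of_nonneg_left (hM t ht).2 (by positivity)
  refine hu.continuousOn (Frequently.of_forall fun n t ht => ?_)
  exact (hW _ (bounded_truncObs f n).comp_fst w t ht).continuousWithinAt

/-- Kolmogorov's forward equation for observables of exponential growth. -/
lemma hasDerivWithinAt_of_growth (hp : OffspringLaw p σ v) (hW : IsGWBSemigroup p W)
    {w : ℕ × ℕ} {a b C M : ℝ} {f : ℕ → ℝ} (hb : 1 ≤ b) (hba : b < a)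
    (hs : Summable fun k => p k * b ^ k)
    (hM : ∀ t, 0 ≤ t → Integrable (fun z => a ^ z.1) (W.P t w) ∧ ∫ z, a ^ z.1 ∂W.P t w ≤ M)
    (hf : ∀ z, |f z| ≤ C * b ^ z) {t : ℝ} (ht : 0 ≤ t) :
    HasDerivWithinAt (fun u => ∫ z, f z.1 ∂W.P u w) (∫ z, gwQ p f z.1 ∂W.P t w) (Ici 0) t := by
  have hb0 : 0 < b := by linarith
  obtain ⟨c, hbc, hca⟩ := exists_between hba
  obtain ⟨C', hC'⟩ := hp.exists_abs_gwQ_le hb hs hbc C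
  have hc0 : 0 < c := hb0.trans hbc
  have htr : ∀ n z, |truncObs f n z| ≤ C * b ^ z := fun n z => (abs_truncObs_le f n z).trans (hf z)
  have hcont : ∀ g : ℕ → ℝ, (∀ z, |g z| ≤ C * b ^ z) →
      Continuous fun s => ∫ z, gwQ p g z.1 ∂W.P (max s 0) w := fun g hg =>
    (hW.continuousOn_integral_of_growth hc0 hca hM (hC' g hg)).comp_continuous
      (continuous_id.max continuous_const) fun s => mem_Ici.2 (le_max_right s 0)
  have hC'0 : 0 ≤ C' := by simpa using (abs_nonneg _).trans (hC' f hf 0)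
  have hftc : ∀ u, 0 ≤ u → ∀ n, ∫ z, truncObs f n z.1 ∂W.P u w =
      truncObs f n w.1 + ∫ s in (0 : ℝ)..u, ∫ z, gwQ p (truncObs f n) z.1 ∂W.P (max s 0) w :=
    fun u hu n => by
      have hd := hW _ (bounded_truncObs f n).comp_fst w
      have := intervalIntegral.integral_eq_sub_of_hasDeriv_right_of_le hu
        (f := fun s => ∫ z, truncObs f n z.1 ∂W.P s w)
        (fun s hs => (hd s hs.1).continuousWithinAt.mono Icc_subset_Ici_self)
        (f' := fun s => ∫ z, gwQ p (truncObs f n) z.1 ∂W.P (max s 0) w)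
        (fun s hs => by
          rw [max_eq_left hs.1.le]
          exact (hd s hs.1.le).mono fun r (hr : s < r) => hs.1.le.trans hr.le)
        ((hcont _ (htr n)).intervalIntegrable _ _)
      rw [this, integral_zero]
      ring
  have hint : ∀ u, 0 ≤ u → ∫ z, f z.1 ∂W.P u w =
      f w.1 + ∫ s in (0 : ℝ)..u, ∫ z, gwQ p f z.1 ∂W.P (max s 0) w := fun u hu => by
    refine tendsto_nhds_unique (tendsto_integral_of_growth (hM u hu).1
      (fun n => growth_mono hb0.le hba.le (htr n)) (tendsto_truncObs f)) ?_
    simp only [hftc u hu]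
    refine (tendsto_truncObs f w.1).add ?_
    refine intervalIntegral.tendsto_integral_filter_of_dominated_convergence (fun _ => C' * M)
      (Eventually.of_forall fun n => (hcont _ (htr n)).aestronglyMeasurable)
      (Eventually.of_forall fun n => Eventually.of_forall fun s _ => ?_)
      intervalIntegrable_const (Eventually.of_forall fun s _ => ?_)
    · refine (abs_integral_le_of_growth (hM _ (le_max_right s 0)).1
        (growth_mono hc0.le hca.le (hC' _ (htr n)))).trans ?_
      exact mul_le_mul_of_nonneg_left (hM _ (le_max_right s 0)).2 hC'0
    · exact tendsto_integral_of_growth (hM _ (le_max_right s 0)).1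
        (fun n => growth_mono hc0.le hca.le (hC' _ (htr n)))
        (hp.tendsto_gwQ hb hs htr hf (tendsto_truncObs f))
  have hmain := ((hcont f hf).integral_hasStrictDerivAt 0 t).hasDerivAt.const_add (f w.1)
  rw [max_eq_left ht] at hmain
  exact hmain.hasDerivWithinAt.congr_of_mem (fun u hu => hint u hu) ht

/-- A bounded exponential moment forces the exponential to be excessive. -/
lemma tsum_mul_pow_le (hp : OffspringLaw p σ v) (hW : IsGWBSemigroup p W)
    {a b M : ℝ} (hb : 1 < b) (hba : b < a) (hs : Summable fun k => p k * b ^ k)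
    (hM : ∀ t, 0 ≤ t → Integrable (fun z => a ^ z.1) (W.P t (1, 0)) ∧
      ∫ z, a ^ z.1 ∂W.P t (1, 0) ≤ M) :
    ∑' k, p k * b ^ k ≤ b := by
  by_contra! hlt
  set c := ∑' k, p k * b ^ k - b with hc
  have hc0 : 0 < c := sub_pos.2 hlt
  have hb0 : 0 < b := by linarith
  have hf : ∀ z : ℕ, |b ^ z| ≤ 1 * b ^ z := fun z => by rw [one_mul, abs_of_pos (by positivity)]
  have hQ : ∀ z : ℕ, c * (b ^ z - 1) / (b - 1) ≤ gwQ p (fun z => b ^ z) z := fun z => by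
    rw [hp.gwQ_eq hb.le hs hf]
    rcases z with _ | z
    · simp
    have h1 : ∑' k, p k * b ^ (z + 1 + k - 1) = b ^ z * ∑' k, p k * b ^ k := by
      rw [← tsum_mul_left]
      refine tsum_congr fun k => ?_
      rw [show z + 1 + k - 1 = z + k by omega, pow_add]
      ring
    have h2 : b ^ (z + 1) - 1 ≤ (z + 1 : ℕ) * b ^ z * (b - 1) := by
      rw [← geom_sum_mul]
      refine mul_le_mul_of_nonneg_right ?_ (by linarith)
      refine (Finset.sum_le_card_nsmul _ _ (b ^ z) fun k hk => ?_).trans_eq (by simp)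
      exact pow_le_pow_right₀ hb.le (by have := Finset.mem_range.1 hk; omega)
    rw [h1, div_le_iff₀ (by linarith)]
    calc c * (b ^ (z + 1) - 1) ≤ c * ((z + 1 : ℕ) * b ^ z * (b - 1)) :=
          mul_le_mul_of_nonneg_left h2 hc0.le
      _ = _ := by rw [hc]; ring
  have hd := fun t ht => hasDerivWithinAt_of_growth hp hW (t := t) hb.le hba hs hM hf ht
  have hi : ∀ t, 0 ≤ t → Integrable (fun z => b ^ z.1) (W.P t (1, 0)) := fun t ht =>
    integrable_of_growth (hM t ht).1 (growth_mono hb0.le hba.le hf)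
  have hiQ : ∀ t, 0 ≤ t → Integrable (fun z => gwQ p (fun z => b ^ z) z.1) (W.P t (1, 0)) := by
    obtain ⟨C', hC'⟩ := hp.exists_abs_gwQ_le hb.le hs hba 1
    exact fun t ht => integrable_of_growth (hM t ht).1 (hC' _ hf)
  have hge : ∀ t, 0 ≤ t → b ≤ ∫ z, b ^ z.1 ∂W.P t (1, 0) := fun t ht => by
    have := add_mul_le_of_le_derivWithin (c := 0) ht hd fun s hs _ => integral_nonneg fun z =>
      (div_nonneg (mul_nonneg hc0.le (sub_nonneg.2 (one_le_pow₀ hb.le))) (by linarith)).trans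
        (hQ z.1)
    simpa [integral_zero] using this
  have hgrow : ∀ t, 0 ≤ t → b + c * t ≤ M := fun t ht => by
    have h1 := add_mul_le_of_le_derivWithin (c := c) ht hd fun s hs _ => by
      have := W.prob s (1, 0)
      have h2 : ∫ z, c * (b ^ z.1 - 1) / (b - 1) ∂W.P s (1, 0) ≤
          ∫ z, gwQ p (fun z => b ^ z) z.1 ∂W.P s (1, 0) :=
        integral_mono ((((hi s hs).sub (integrable_const 1)).const_mul c).div_const _)
          (hiQ s hs) fun z => hQ z.1
      rw [integral_div, integral_const_mul, integral_sub (hi s hs) (integrable_const 1)] at h2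
      simp only [integral_const, probReal_univ, smul_eq_mul, mul_one] at h2
      refine le_trans ?_ h2
      rw [le_div_iff₀ (by linarith)]
      exact mul_le_mul_of_nonneg_left (by linarith [hge s hs]) hc0.le
    simp only [integral_zero, pow_one] at h1
    refine h1.trans ((integral_mono (hi t ht) (hM t ht).1 fun z => ?_).trans (hM t ht).2)
    exact pow_le_pow_left₀ hb0.le hba.le _
  have hM0 : 0 ≤ M := by linarith [hgrow 0 le_rfl]
  have := hgrow (M / c) (by positivity)
  rw [mul_div_cancel₀ _ hc0.ne'] at this
  linarith

end IsGWBSemigroup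

/-- **Kolmogorov equations for the Galton-Watson semigroup on the class `F`.**
If `E exp(σ' H¹) < ∞` (with `H¹` the total number of births, encoded through
the birth-counting process `W`), then for every `f` with
`∑_ℓ e^{-ρℓ}|f(ℓ)| < ∞` for some `ρ < σ'`, the generator `Qf` is well defined
and `d/dt S_t f = Q S_t f = S_t Q f`. -/
theorem gw_kolmogorov_equations
    (p : ℕ → ℝ) (σ v : ℝ) (hp : OffspringLaw p σ v)
    (W : MarkovSemigroup (ℕ × ℕ)) (hW : IsGWBSemigroup p W)
    (σ' : ℝ) (hσ' : 0 < σ') (hH : HMomentFinite W σ')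
    (f : ℕ → ℝ) (hf : MemF σ' f) :
    (∀ x : ℕ, Summable fun k : ℕ => (x : ℝ) * p k * (f (x + k - 1) - f x)) ∧
    ∀ x : ℕ, ∀ t : ℝ, 0 ≤ t →
      HasDerivWithinAt (fun u => gwS W u f x)
        (gwQ p (fun y => gwS W t f y) x) (Set.Ici 0) t ∧
      gwQ p (fun y => gwS W t f y) x = gwS W t (gwQ p f) x := by
  obtain ⟨ρ, hρ, hfs⟩ := hf
  obtain ⟨ρ', hρ', hρσ⟩ := exists_between (max_lt hρ hσ')
  set a := Real.exp σ' with ha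
  set c := Real.exp ρ' with hc
  set b := Real.exp (max ρ 0) with hb
  have hb1 : 1 ≤ b := Real.one_le_exp (le_max_right _ _)
  have hbc : b < c := Real.exp_lt_exp.2 hρ'
  have hca : c < a := Real.exp_lt_exp.2 hρσ
  have hc1 : 1 < c := hb1.trans_lt hbc
  have ha1 : 1 ≤ a := (hc1.trans hca).le
  obtain ⟨C, hC⟩ : ∃ C, ∀ z, |f z| ≤ C * b ^ z := by
    refine ⟨∑' ℓ : ℕ, Real.exp (-ρ * ℓ) * |f ℓ|, fun z => ?_⟩
    have h1 : Real.exp (-ρ * z) * |f z| ≤ ∑' ℓ : ℕ, Real.exp (-ρ * ℓ) * |f ℓ| :=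
      hfs.le_tsum z fun j _ => by positivity
    have h2 : Real.exp (ρ * z) ≤ b ^ z := by
      rw [hb, ← Real.exp_nat_mul, mul_comm]
      exact Real.exp_le_exp.2 (mul_le_mul_of_nonneg_left (le_max_left _ _) z.cast_nonneg)
    calc |f z| = Real.exp (-ρ * z) * |f z| * Real.exp (ρ * z) := by
          rw [mul_right_comm, ← Real.exp_add, neg_mul, neg_add_cancel, Real.exp_zero, one_mul]
      _ ≤ _ := mul_le_mul h1 h2 (Real.exp_pos _).le (tsum_nonneg fun j => by positivity)
  obtain ⟨M, hM⟩ := hH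
  have hbirth : ∀ t, 0 ≤ t → Integrable (fun z => a ^ (1 + z.2)) (W.P t (1, 0)) ∧
      ∫ z, a ^ (1 + z.2) ∂W.P t (1, 0) ≤ max M 0 := fun t ht => by
    have he : ∀ z : ℕ × ℕ, Real.exp (σ' * (1 + (z.2 : ℝ))) = a ^ (1 + z.2) := fun z => by
      rw [ha, ← Real.exp_nat_mul, mul_comm]
      push_cast
      rfl
    have h1 := hM t ht
    simp only [he] at h1
    have hnn : 0 ≤ᵐ[W.P t (1, 0)] fun z : ℕ × ℕ => a ^ (1 + z.2) :=
      Eventually.of_forall fun z => by positivity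
    have hi : Integrable (fun z => a ^ (1 + z.2)) (W.P t (1, 0)) := by
      refine ⟨Measurable.of_discrete.aestronglyMeasurable, ?_⟩
      rw [hasFiniteIntegral_iff_ofReal hnn]
      exact h1.trans_lt ENNReal.ofReal_lt_top
    refine ⟨hi, ?_⟩
    rw [← ofReal_integral_eq_lintegral_ofReal hi hnn] at h1
    exact (ENNReal.ofReal_le_ofReal_iff (le_max_right _ _)).1
      (h1.trans (ENNReal.ofReal_le_ofReal (le_max_left _ _)))
  have hpop : ∀ t, 0 ≤ t → Integrable (fun z => a ^ z.1) (W.P t (1, 0)) ∧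
      ∫ z, a ^ z.1 ∂W.P t (1, 0) ≤ max M 0 := fun t ht => by
    have hle : ∀ᵐ z ∂W.P t (1, 0), a ^ z.1 ≤ a ^ (1 + z.2) := by
      filter_upwards [hW.ae_fst_le hp.nonneg ht] with z hz using pow_le_pow_right₀ ha1 hz
    have hi : Integrable (fun z => a ^ z.1) (W.P t (1, 0)) := by
      refine (hbirth t ht).1.mono' Measurable.of_discrete.aestronglyMeasurable ?_
      filter_upwards [hle] with z hz
      rwa [Real.norm_eq_abs, abs_of_nonneg (by positivity)]
    exact ⟨hi, (integral_mono_ae hi (hbirth t ht).1 hle).trans (hbirth t ht).2⟩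
  have hsum : ∀ {r : ℝ}, 1 ≤ r → r ≤ a → Summable fun k => p k * r ^ k := fun hr hra =>
    (IsGWBSemigroup.summable_offspring_pow hp hW ha1 hbirth).of_nonneg_of_le
      (fun k => mul_nonneg (hp.nonneg k) (by positivity))
      fun k => mul_le_mul_of_nonneg_left (pow_le_pow_left₀ (by linarith) hra k) (hp.nonneg k)
  have hsb := hsum hb1 (hbc.trans hca).le
  have hsc := hsum hc1.le hca.le
  have hcc := IsGWBSemigroup.tsum_mul_pow_le hp hW hc1 hca hsc hpop
  have hmom : ∀ w t, 0 ≤ t → Integrable (fun z => c ^ z.1) (W.P t w) ∧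
      ∫ z, c ^ z.1 ∂W.P t w ≤ c ^ w.1 := fun w t ht =>
    IsGWBSemigroup.integrable_and_integral_le hp hW (V := fun z => c ^ z.1)
      (fun z => by positivity) (fun z hz => by
        obtain ⟨n, hn⟩ := Nat.exists_eq_add_of_le' hz
        have h1 : ∀ k, p k * c ^ (z.1 + k - 1) = c ^ n * (p k * c ^ k) := fun k => by
          rw [hn, show n + 1 + k - 1 = n + k by omega, pow_add]
          ring
        simp only [h1]
        refine ⟨hsc.mul_left _, ?_⟩
        rw [tsum_mul_left, hn, pow_succ]
        exact mul_le_mul_of_nonneg_left hcc (by positivity)) w ht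
  have hcomm : ∀ x : ℕ, ∀ t : ℝ, 0 ≤ t →
      gwQ p (fun y => gwS W t f y) x = gwS W t (gwQ p f) x := fun x t ht => by
    have hC0 : 0 ≤ C := by simpa using (abs_nonneg _).trans (hC 0)
    have htr : ∀ n z, |truncObs f n z| ≤ C * b ^ z :=
      fun n z => (abs_truncObs_le f n z).trans (hC z)
    have hgrow : ∀ g : ℕ → ℝ, (∀ z, |g z| ≤ C * b ^ z) → ∀ z, |gwS W t g z| ≤ C * c ^ z :=
      fun g hg z => (IsGWBSemigroup.abs_integral_le_of_growth (hmom (z, 0) t ht).1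
        (IsGWBSemigroup.growth_mono (by linarith) hbc.le hg)).trans
        (mul_le_mul_of_nonneg_left (hmom (z, 0) t ht).2 hC0)
    obtain ⟨C', hC'⟩ := hp.exists_abs_gwQ_le hb1 hsb hbc C
    have hleft := hp.tendsto_gwQ hc1.le hsc (F := fun n z => gwS W t (truncObs f n) z)
      (fun n => hgrow _ (htr n)) (hgrow f hC) (fun z =>
        IsGWBSemigroup.tendsto_integral_of_growth (hmom (z, 0) t ht).1
          (fun n => IsGWBSemigroup.growth_mono (by linarith) hbc.le (htr n))
          (tendsto_truncObs f)) x
    have hright := IsGWBSemigroup.tendsto_integral_of_growth (hmom (x, 0) t ht).1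
      (fun n => hC' _ (htr n)) (hp.tendsto_gwQ hb1 hsb htr hC (tendsto_truncObs f))
    refine tendsto_nhds_unique hleft (hright.congr fun n => ?_)
    have h1 := hW.gwbGen_integral (bounded_truncObs f n).comp_fst (x, 0) ht
    refine h1.symm.trans (tsum_congr fun k => ?_)
    exact congrArg (fun a => (x : ℝ) * p k * (a - _))
      (IsGWBSemigroup.integral_fst_eq hp hW (bounded_truncObs f n) ht (x + k - 1) (0 + k))
  refine ⟨fun x => ?_, fun x t ht => ⟨?_, hcomm x t ht⟩⟩
  · refine (((hp.summable_mul_shift hb1 hsb hC x).sub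
      (hp.hasSum_one.summable.mul_right (f x))).mul_left (x : ℝ)).congr fun k => ?_
    ring
  · rw [hcomm x t ht]
    exact IsGWBSemigroup.hasDerivWithinAt_of_growth hp hW hb1 hbc hsb (hmom (x, 0)) hC ht

end
end
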